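/- Let d ≥ 1 be a natural number, v = (d-2)/2, and α ∈ (0,1]. Suppose φ : (1,∞) × [0,∞) → ℝ is bounded and continuous, is twice continuously differentiable in the first variable and once continuously differentiable in the second variable on (1,∞) × (0,∞), and satisfies φ(r,0) = 0 for all r > 1. Suppose further that for every r > 1 and every λ > 0: (i) K_v(√(2λ)) ≠ 0 and ∫₀^∞ e^{-λτ} φ(r,τ) dτ = α · r^{-v} · K_v(r√(2λ)) / (λ · K_v(√(2λ))); (ii) the Laplace transforms in τ of ∂φ/∂r, ∂²φ/∂r², and ∂φ/∂τ exist, and ∫₀^∞ e^{-λτ} (∂φ/∂r)(r,τ) dτ = ∂/∂r ∫₀^∞ e^{-λτ} φ(r,τ) dτ, ∫₀^∞ e^{-λτ} (∂²φ/∂r²)(r,τ) dτ = ∂²/∂r² ∫₀^∞ e^{-λτ} φ(r,τ) dτ, and ∫₀^∞ e^{-λτ} (∂φ/∂τ)(r,τ) dτ = λ ∫₀^∞ e^{-λτ} φ(r,τ) dτ. Then φ satisfies the radial heat equation ∂φ/∂τ (r,τ) = (1/2) ∂²φ/∂r² (r,τ) + ((d-1)/(2r)) ∂φ/∂r (r,τ)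 for all r > 1 and τ > 0. -/

import Mathlib

open Real MeasureTheory Set Filter

/-- The modified Bessel function of the second kind for real argument `x > 0`,
defined via the integral representation. -/
noncomputable def besselK (v : ℝ) (x : ℝ) : ℝ :=
  Real.pi ^ (-(1 : ℝ)/2) * Real.Gamma (v + 1/2) * (2*x) ^ v *
    ∫ t in Set.Ioi (0:ℝ), Real.cos t * (t^2 + x^2) ^ (-(v + 1/2))

/-- The integral appearing in `besselK`, as a function of the exponent and of the argument. -/
noncomputable def cosKernelIntegral (s x : ℝ) : ℝ :=
  ∫ t in Set.Ioi (0:ℝ), Real.cos t * (t^2 + x^2) ^ (-s)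

lemma rpow_neg_sq_add_sq_le {s δ x : ℝ} (hs : 1 ≤ s) (hδ : 0 < δ) (hδ1 : δ ≤ 1) (hx : δ ≤ x)
    (t : ℝ) : (t^2 + x^2) ^ (-s) ≤ (δ^2) ^ (-s) * (1 + t^2)⁻¹ := by
  have h1 : δ^2 * (1 + t^2) ≤ t^2 + x^2 := by
    have : δ^2 ≤ 1 := by nlinarith
    have : δ^2 ≤ x^2 := by nlinarith
    nlinarith [sq_nonneg t]
  calc (t^2 + x^2) ^ (-s) ≤ (δ^2 * (1 + t^2)) ^ (-s) :=
        Real.rpow_le_rpow_of_nonpos (by positivity) h1 (by linarith)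
    _ = (δ^2) ^ (-s) * (1 + t^2) ^ (-s) := Real.mul_rpow (by positivity) (by positivity)
    _ ≤ (δ^2) ^ (-s) * (1 + t^2)⁻¹ := by
        gcongr
        rw [← Real.rpow_neg_one]
        exact Real.rpow_le_rpow_of_exponent_le (by nlinarith [sq_nonneg t]) (by linarith)

lemma continuous_cos_mul_rpow (s : ℝ) {x : ℝ} (hx : 0 < x) :
    Continuous fun t : ℝ => Real.cos t * (t^2 + x^2) ^ (-s) :=
  Real.continuous_cos.mul <| Continuous.rpow_const (by fun_prop) fun t => Or.inl (by positivity)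

lemma integrable_cos_mul_rpow {s x : ℝ} (hs : 1 ≤ s) (hx : 0 < x) :
    Integrable fun t : ℝ => Real.cos t * (t^2 + x^2) ^ (-s) := by
  refine Integrable.mono' (integrable_inv_one_add_sq.const_mul (((min 1 x)^2) ^ (-s)))
    (continuous_cos_mul_rpow s hx).aestronglyMeasurable (Eventually.of_forall fun t => ?_)
  have h0 : 0 < min 1 x := lt_min one_pos hx
  rw [norm_mul, Real.norm_of_nonneg (show 0 ≤ (t^2 + x^2) ^ (-s) by positivity)]
  calc ‖Real.cos t‖ * (t^2 + x^2) ^ (-s) ≤ 1 * (t^2 + x^2) ^ (-s) := by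
        gcongr; exact Real.abs_cos_le_one t
    _ ≤ _ := by
        rw [one_mul]
        exact rpow_neg_sq_add_sq_le hs h0 (min_le_left _ _) (min_le_right _ _) t

lemma hasDerivAt_cosKernelIntegral {s x : ℝ} (hs : 1 ≤ s) (hx : 0 < x) :
    HasDerivAt (cosKernelIntegral s) (-(2 * s) * x * cosKernelIntegral (s + 1) x) x := by
  set δ := min 1 (x / 2) with hδ
  have hδ0 : 0 < δ := lt_min one_pos (by positivity)
  have key := hasDerivAt_integral_of_dominated_loc_of_deriv_le
    (μ := volume.restrict (Ioi (0:ℝ))) (x₀ := x) (s := Metric.ball x (x / 2))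
    (F := fun y t => Real.cos t * (t^2 + y^2) ^ (-s))
    (F' := fun y t => -(2 * s) * y * (Real.cos t * (t^2 + y^2) ^ (-(s + 1))))
    (bound := fun t => 2 * s * (2 * x) * ((δ^2) ^ (-(s + 1)) * (1 + t^2)⁻¹))
    (Metric.ball_mem_nhds _ (by positivity))
    ?_ (integrable_cos_mul_rpow hs hx).integrableOn ?_ ?_ ?_ ?_
  · have h := key.2
    simp only [integral_const_mul] at h
    exact h
  · filter_upwards [lt_mem_nhds hx] with y hy
    exact (continuous_cos_mul_rpow s hy).aestronglyMeasurable
  · exact ((continuous_cos_mul_rpow (s + 1) hx).const_mul _).aestronglyMeasurable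
  · refine Eventually.of_forall fun t y hy => ?_
    rw [Metric.mem_ball, Real.dist_eq, abs_lt] at hy
    have hy0 : 0 < y := by linarith
    have hδy : δ ≤ y := (min_le_right _ _).trans (by linarith)
    rw [norm_mul, norm_mul, norm_mul, Real.norm_of_nonneg hy0.le,
      Real.norm_of_nonneg (show 0 ≤ (t^2 + y^2) ^ (-(s + 1)) by positivity), norm_neg,
      Real.norm_of_nonneg (show 0 ≤ 2 * s by linarith)]
    have h1 := rpow_neg_sq_add_sq_le (s := s + 1) (by linarith) hδ0 (min_le_left _ _) hδy t
    have h2 : ‖Real.cos t‖ ≤ 1 := Real.abs_cos_le_one t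
    have h3 : ‖Real.cos t‖ * (t^2 + y^2) ^ (-(s + 1)) ≤ (δ^2) ^ (-(s + 1)) * (1 + t^2)⁻¹ :=
      (mul_le_of_le_one_left (by positivity) h2).trans h1
    gcongr
    linarith
  · exact (integrable_inv_one_add_sq.integrableOn.const_mul _).const_mul _
  · refine Eventually.of_forall fun t y hy => ?_
    rw [Metric.mem_ball, Real.dist_eq, abs_lt] at hy
    have hy0 : 0 < y := by linarith
    have h := (((hasDerivAt_id y).pow 2).const_add (t^2)).rpow_const (p := -s)
      (Or.inl (by simp; positivity))
    refine (h.const_mul (Real.cos t)).congr_deriv ?_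
    simp only [id, Pi.pow_apply, show -s - 1 = -(s + 1) by ring]
    push_cast
    ring

lemma cosKernelIntegral_recurrence {s x : ℝ} (hs : 1 ≤ s) (hx : 0 < x) :
    cosKernelIntegral s x + (4 * s^2 + 2 * s) * cosKernelIntegral (s + 1) x
      - 4 * s * (s + 1) * x^2 * cosKernelIntegral (s + 2) x = 0 := by
  have hint : ∀ k : ℝ, 0 ≤ k →
      IntegrableOn (fun t : ℝ => Real.cos t * (t^2 + x^2) ^ (-(s + k))) (Ioi 0) := fun k hk =>
    (integrable_cos_mul_rpow (by linarith) hx).integrableOn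
  have i0 : IntegrableOn (fun t : ℝ => Real.cos t * (t^2 + x^2) ^ (-s)) (Ioi 0) :=
    (integrable_cos_mul_rpow hs hx).integrableOn
  have i1 := (hint 1 (by norm_num)).const_mul (4 * s^2 + 2 * s)
  have i2 := (hint 2 (by norm_num)).const_mul (4 * s * (s + 1) * x^2)
  have i01 : Integrable (fun t : ℝ => Real.cos t * (t^2 + x^2) ^ (-s)
      + (4 * s^2 + 2 * s) * (Real.cos t * (t^2 + x^2) ^ (-(s + 1))))
      (volume.restrict (Ioi 0)) := i0.add i1
  have hpos : ∀ t : ℝ, 0 < t^2 + x^2 := fun t => by positivity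
  have hq : ∀ (p t : ℝ), HasDerivAt (fun t : ℝ => (t^2 + x^2) ^ p)
      (2 * t * p * (t^2 + x^2) ^ (p - 1)) t := fun p t => by
    have h := (((hasDerivAt_id t).pow 2).add_const (x^2)).rpow_const (p := p)
      (Or.inl (by simpa using (hpos t).ne'))
    refine h.congr_deriv ?_
    simp
  have key := integral_Ioi_of_hasDerivAt_of_tendsto' (a := (0:ℝ)) (m := 0)
    (f := fun t => Real.cos t * (-(2 * s) * (t * (t^2 + x^2) ^ (-(s + 1))))
      + Real.sin t * (t^2 + x^2) ^ (-s))
    (f' := fun t => Real.cos t * (t^2 + x^2) ^ (-s)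
      + (4 * s^2 + 2 * s) * (Real.cos t * (t^2 + x^2) ^ (-(s + 1)))
      - 4 * s * (s + 1) * x^2 * (Real.cos t * (t^2 + x^2) ^ (-(s + 2)))) ?_ ?_ ?_
  · rw [integral_sub i01 i2, integral_add i0 i1, integral_const_mul,
      integral_const_mul] at key
    simpa [cosKernelIntegral] using key
  · intro t _
    have h1 := (hasDerivAt_id t).mul (hq (-(s + 1)) t)
    have h := ((Real.hasDerivAt_cos t).mul (h1.const_mul (-(2 * s)))).add
      ((Real.hasDerivAt_sin t).mul (hq (-s) t))
    refine h.congr_deriv ?_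
    have e1 : (t^2 + x^2) ^ (-(s + 1)) = (t^2 + x^2) * (t^2 + x^2) ^ (-(s + 2)) := by
      rw [← Real.rpow_one_add' (hpos t).le (by linarith)]
      congr 1; ring
    simp only [id, Pi.mul_apply, show -(s + 1) - 1 = -(s + 2) by ring,
      show -s - 1 = -(s + 1) by ring, e1]
    ring
  · exact i01.sub i2
  · have hδ0 : 0 < min 1 x := lt_min one_pos hx
    set A := ((min 1 x)^2) ^ (-s)
    set D := ((min 1 x)^2) ^ (-(s + 1))
    have hlim : Tendsto (fun t : ℝ => (1 + t^2)⁻¹ * t) atTop (nhds 0) := by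
      refine squeeze_zero' (g := fun t : ℝ => t⁻¹) ?_ ?_ tendsto_inv_atTop_zero
      · filter_upwards [eventually_ge_atTop 0] with t ht
        positivity
      · filter_upwards [eventually_gt_atTop 0] with t ht
        rw [inv_mul_eq_div, div_le_iff₀ (by positivity)]
        field_simp
        nlinarith
    have hlim' : Tendsto (fun t : ℝ => (2 * s * D + A) * ((1 + t^2)⁻¹ * t)) atTop (nhds 0) := by
      simpa using hlim.const_mul (2 * s * D + A)
    refine squeeze_zero_norm' ?_ hlim'
    filter_upwards [eventually_ge_atTop 1] with t ht
    have b1 := rpow_neg_sq_add_sq_le (s := s + 1) (by linarith) hδ0 (min_le_left 1 x)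
      (min_le_right 1 x) t
    have b0 := rpow_neg_sq_add_sq_le hs hδ0 (min_le_left 1 x) (min_le_right 1 x) t
    refine (norm_add_le _ _).trans ?_
    rw [norm_mul, norm_mul (Real.sin t), norm_mul, norm_mul, norm_neg,
      Real.norm_of_nonneg (show 0 ≤ (t^2 + x^2) ^ (-(s + 1)) by positivity),
      Real.norm_of_nonneg (show 0 ≤ (t^2 + x^2) ^ (-s) by positivity),
      Real.norm_of_nonneg (show 0 ≤ 2 * s by linarith),
      Real.norm_of_nonneg (show 0 ≤ t by linarith)]
    have hA : 0 ≤ A := by positivity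
    calc _ ≤ 1 * (2 * s * (t * (D * (1 + t^2)⁻¹))) + 1 * (A * (1 + t^2)⁻¹ * t) := by
          gcongr
          · exact Real.abs_cos_le_one t
          · exact Real.abs_sin_le_one t
          · exact b0.trans (le_mul_of_one_le_right (by positivity) ht)
      _ = _ := by ring

/-- `cosKernelIntegral s` solves `y'' + (2s/x) y' = y`. -/
lemma hasDerivAt_deriv_cosKernelIntegral {s x : ℝ} (hs : 1 ≤ s) (hx : 0 < x) :
    HasDerivAt (fun y => -(2 * s) * y * cosKernelIntegral (s + 1) y)
      (cosKernelIntegral s x - 2 * s / x * (-(2 * s) * x * cosKernelIntegral (s + 1) x)) x := by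
  have h := ((hasDerivAt_id x).const_mul (-(2 * s))).mul
    (hasDerivAt_cosKernelIntegral (s := s + 1) (by linarith) hx)
  refine h.congr_deriv ?_
  have := cosKernelIntegral_recurrence hs hx
  rw [show s + 1 + 1 = s + 2 by ring]
  simp only [id]
  field_simp
  linarith

lemma not_integrableOn_cos_mul_rpow {x : ℝ} (hx : 0 < x) :
    ¬ IntegrableOn (fun t : ℝ => Real.cos t * (t^2 + x^2) ^ (-(1/2 : ℝ))) (Ioi 0) := by
  intro h
  have hshift : ∀ (f : ℝ → ℝ) (a : ℝ),
      IntegrableOn (fun t => f (t + a)) (Ioi 0) ↔ IntegrableOn f (Ioi a) := fun f a => by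
    have := (measurePreserving_add_right volume a).integrableOn_comp_preimage
      (measurableEmbedding_addRight a) (f := f) (s := Ioi a)
    simpa [Function.comp_def] using this
  have h2 : IntegrableOn (fun t : ℝ => Real.cos (t + π / 2) *
      ((t + π / 2)^2 + x^2) ^ (-(1/2 : ℝ))) (Ioi 0) :=
    (hshift (fun t => Real.cos t * (t^2 + x^2) ^ (-(1/2 : ℝ))) (π / 2)).2
      (h.mono_set (Ioi_subset_Ioi (by positivity)))
  have hpi : 0 < π / 2 := by positivity
  refine not_integrableOn_Ioi_inv (a := π / 2 + x)
    ((hshift (fun t => t⁻¹) _).1 (Integrable.mono' (h.norm.add h2.norm) ?_ ?_))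
  · exact (Measurable.inv (by fun_prop)).aestronglyMeasurable
  · refine (ae_restrict_iff' measurableSet_Ioi).2 (Eventually.of_forall fun t ht => ?_)
    have ht0 : (0:ℝ) < t := ht
    have hg : ∀ y : ℝ, 0 < y → y ≤ t + π / 2 →
        (t + (π / 2 + x))⁻¹ ≤ (y^2 + x^2) ^ (-(1/2 : ℝ)) := fun y hy hyt => by
      rw [Real.rpow_neg (by positivity), ← Real.sqrt_eq_rpow]
      apply inv_anti₀ (by positivity)
      rw [Real.sqrt_le_iff]
      constructor
      · positivity
      · nlinarith [mul_pos hy hx]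
    have g1 := hg t ht0 (by linarith)
    have g2 := hg (t + π / 2) (by linarith) le_rfl
    simp only [Pi.add_apply, norm_mul, Real.cos_add_pi_div_two, norm_neg]
    rw [Real.norm_of_nonneg (show 0 ≤ (t^2 + x^2) ^ (-(1/2 : ℝ)) by positivity),
      Real.norm_of_nonneg (show 0 ≤ ((t + π / 2)^2 + x^2) ^ (-(1/2 : ℝ)) by positivity),
      Real.norm_of_nonneg (show 0 ≤ (t + (π / 2 + x))⁻¹ by positivity), Real.norm_eq_abs,
      Real.norm_eq_abs]
    have hcs : 1 ≤ |Real.cos t| + |Real.sin t| := by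
      have := Real.sin_sq_add_cos_sq t
      have := Real.abs_cos_le_one t
      have := Real.abs_sin_le_one t
      nlinarith [sq_abs (Real.cos t), sq_abs (Real.sin t), abs_nonneg (Real.cos t),
        abs_nonneg (Real.sin t)]
    have hA : 0 ≤ (t + (π / 2 + x))⁻¹ := by positivity
    calc (t + (π / 2 + x))⁻¹
        ≤ (|Real.cos t| + |Real.sin t|) * (t + (π / 2 + x))⁻¹ := le_mul_of_one_le_left hA hcs
      _ = |Real.cos t| * (t + (π / 2 + x))⁻¹ + |Real.sin t| * (t + (π / 2 + x))⁻¹ := by ring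
      _ ≤ _ := by gcongr

lemma besselK_neg_half (x : ℝ) : besselK (-(1/2)) x = 0 := by
  simp [besselK, Real.Gamma_zero]

lemma besselK_zero {x : ℝ} (hx : 0 < x) : besselK 0 x = 0 := by
  have := integral_undef (not_integrableOn_cos_mul_rpow hx)
  simp only [besselK, zero_add, this, mul_zero]

lemma besselK_eq (v x : ℝ) : besselK v x =
    Real.pi ^ (-(1 : ℝ)/2) * Real.Gamma (v + 1/2) * (2*x) ^ v * cosKernelIntegral (v + 1/2) x :=
  rfl

/-- Second derivative of `r ↦ r ^ p * f r`. -/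
lemma hasDerivAt_rpow_mul_twice {f f₁ : ℝ → ℝ} {f₂ p r : ℝ} (hr : 0 < r)
    (h : HasDerivAt f (f₁ r) r) (h₁ : HasDerivAt f₁ f₂ r) :
    HasDerivAt (fun r => r ^ p * f r) (r ^ p * (p / r * f r + f₁ r)) r ∧
    HasDerivAt (fun r => r ^ p * (p / r * f r + f₁ r))
      (r ^ p * (f₂ + 2 * p / r * f₁ r + p * (p - 1) / r^2 * f r)) r := by
  have hp : HasDerivAt (fun r : ℝ => r ^ p) (p * r ^ p / r) r := by
    refine (Real.hasDerivAt_rpow_const (Or.inl hr.ne')).congr_deriv ?_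
    rw [Real.rpow_sub_one hr.ne', mul_div_assoc]
  constructor
  · refine (hp.mul h).congr_deriv ?_
    field_simp
  · have hd : HasDerivAt (fun r : ℝ => p / r) (-(p / r^2)) r := by
      refine ((hasDerivAt_inv hr.ne').const_mul p).congr_deriv ?_
      field_simp
    refine (hp.mul ((hd.mul h).add h₁)).congr_deriv ?_
    simp only [Pi.mul_apply, Pi.add_apply]
    field_simp
    ring

/-- `r ↦ r ^ s * y (a r)` with `y = cosKernelIntegral s` solves `w'' = (a² + s(s-1)/r²) w`. -/
lemma exists_hasDerivAt_rpow_mul_cosKernelIntegral {s a : ℝ} (hs : 1 ≤ s) (ha : 0 < a) (k : ℝ) :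
    ∃ w₁ : ℝ → ℝ, ∀ r > (0:ℝ),
      HasDerivAt (fun r => k * (r ^ s * cosKernelIntegral s (r * a))) (w₁ r) r ∧
      HasDerivAt w₁ ((a^2 + s * (s - 1) / r^2) *
        (k * (r ^ s * cosKernelIntegral s (r * a)))) r := by
  set y₁ : ℝ → ℝ := fun y => -(2 * s) * y * cosKernelIntegral (s + 1) y with hy₁
  refine ⟨fun r => k * (r ^ s * (s / r * cosKernelIntegral s (r * a) + y₁ (r * a) * a)),
    fun r hr => ?_⟩
  have hra : 0 < r * a := by positivity
  have hm : HasDerivAt (fun r : ℝ => r * a) a r := by simpa using (hasDerivAt_id r).mul_const a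
  have e1 : HasDerivAt (fun r => cosKernelIntegral s (r * a)) (y₁ (r * a) * a) r :=
    HasDerivAt.comp (h₂ := cosKernelIntegral s) r (hasDerivAt_cosKernelIntegral hs hra) hm
  have e2 : HasDerivAt (fun r => y₁ (r * a) * a)
      ((cosKernelIntegral s (r * a) - 2 * s / (r * a) * y₁ (r * a)) * a * a) r :=
    (HasDerivAt.comp (h₂ := y₁) r (hasDerivAt_deriv_cosKernelIntegral hs hra) hm).mul_const a
  obtain ⟨d1, d2⟩ := hasDerivAt_rpow_mul_twice (p := s) hr e1 e2
  refine ⟨d1.const_mul k, (d2.const_mul k).congr_deriv ?_⟩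
  field_simp
  ring

/-- Caccioppoli-type estimate for the real form `a'' = μ a - ω b`, `b'' = μ b + ω a` of the
complex equation `w'' = (μ + iω) w`, where `μ ≥ 0`. -/
lemma mul_le_of_hasDerivAt_system {a b a₁ b₁ μ : ℝ → ℝ} {ω y h S q₀ : ℝ} (hω : 0 ≤ ω) (hh : 0 < h)
    (ha : ∀ r ∈ Icc (y - h) (y + h), HasDerivAt a (a₁ r) r)
    (hb : ∀ r ∈ Icc (y - h) (y + h), HasDerivAt b (b₁ r) r)
    (ha₁ : ∀ r ∈ Icc (y - h) (y + h), HasDerivAt a₁ (μ r * a r - ω * b r) r)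
    (hb₁ : ∀ r ∈ Icc (y - h) (y + h), HasDerivAt b₁ (μ r * b r + ω * a r) r)
    (hμ : ∀ r ∈ Icc (y - h) (y + h), 0 ≤ μ r)
    (hS : ∀ r ∈ Icc (y - h) (y + h), a r ^ 2 + b r ^ 2 ≤ S)
    (hq : ∀ r ∈ Icc (y - h) (y + h), q₀ ≤ a r ^ 2 + b r ^ 2) :
    ω * q₀ * h ^ 2 ≤ 20 * S := by
  set B : ℝ → ℝ := fun r =>
    (h^2 - (r - y)^2)^2 * (a r * b₁ r - b r * a₁ r)
    + (h^2 - (r - y)^2)^2 * (2 * (a r * a₁ r + b r * b₁ r))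
    + 4 * (r - y) * (h^2 - (r - y)^2) * (a r ^ 2 + b r ^ 2)
    - ω * q₀ * (h^4 * (r - y) - 2 * h^2 / 3 * (r - y)^3 + (r - y)^5 / 5)
    + 10 * h^2 * S * r with hB
  have hder : ∀ r ∈ Icc (y - h) (y + h), HasDerivAt B
      (2 * ((((h^2 - (r - y)^2) * a₁ r + (r - y) * b r)^2
          + ((h^2 - (r - y)^2) * b₁ r - (r - y) * a r)^2))
        + (h^2 - (r - y)^2)^2 * (2 * μ r * (a r ^ 2 + b r ^ 2)
          + ω * (a r ^ 2 + b r ^ 2 - q₀))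
        + (4 * h^2 - 14 * (r - y)^2) * (a r ^ 2 + b r ^ 2) + 10 * h^2 * S) r := by
    intro r hr
    have hu : HasDerivAt (fun r : ℝ => r - y) 1 r := (hasDerivAt_id r).sub_const y
    have he : HasDerivAt (fun r : ℝ => h^2 - (r - y)^2) (-(2 * (r - y))) r := by
      simpa using (hu.pow 2).const_sub (h^2)
    have hq' : HasDerivAt (fun r => a r ^ 2 + b r ^ 2) (2 * a r * a₁ r + 2 * b r * b₁ r) r := by
      refine (((ha r hr).pow 2).add ((hb r hr).pow 2)).congr_deriv ?_
      push_cast; ring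
    have hJ := ((ha r hr).mul (hb₁ r hr)).sub ((hb r hr).mul (ha₁ r hr))
    have hP := (((ha r hr).mul (ha₁ r hr)).add ((hb r hr).mul (hb₁ r hr))).const_mul 2
    have hX := (((hu.const_mul (h^4)).sub ((hu.pow 3).const_mul (2 * h^2 / 3))).add
      ((hu.pow 5).div_const 5)).const_mul (ω * q₀)
    have hall := (((((he.pow 2).mul hJ).add ((he.pow 2).mul hP)).add
      (((hu.const_mul 4).mul he).mul hq')).sub hX).add ((hasDerivAt_id r).const_mul (10 * h^2 * S))
    refine hall.congr_deriv ?_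
    simp only [Pi.mul_apply, Pi.add_apply, Pi.sub_apply, Pi.pow_apply]
    push_cast
    ring
  have hmono : MonotoneOn B (Icc (y - h) (y + h)) := by
    refine monotoneOn_of_deriv_nonneg (convex_Icc _ _)
      (fun r hr => (hder r hr).continuousAt.continuousWithinAt)
      (fun r hr => (hder r (interior_subset hr)).differentiableAt.differentiableWithinAt)
      fun r hr => ?_
    have hr' := interior_subset hr
    rw [(hder r hr').deriv]
    have hu2 : (r - y)^2 ≤ h^2 := by
      obtain ⟨h1, h2⟩ := hr'
      nlinarith
    have h1 := hS r hr'
    have h2 := hq r hr'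
    have h3 := hμ r hr'
    have h4 : 0 ≤ a r ^ 2 + b r ^ 2 := by positivity
    have t1 : 0 ≤ (h^2 - (r - y)^2)^2 * (2 * μ r * (a r ^ 2 + b r ^ 2)
        + ω * (a r ^ 2 + b r ^ 2 - q₀)) :=
      mul_nonneg (sq_nonneg _) (add_nonneg (by positivity) (mul_nonneg hω (by linarith)))
    have t2 : 0 ≤ (4 * h^2 - 14 * (r - y)^2) * (a r ^ 2 + b r ^ 2) + 10 * h^2 * S := by
      nlinarith [mul_nonneg (sub_nonneg.2 hu2) h4, mul_nonneg (sq_nonneg h) (sub_nonneg.2 h1)]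
    have t3 : 0 ≤ 2 * ((((h^2 - (r - y)^2) * a₁ r + (r - y) * b r)^2
          + ((h^2 - (r - y)^2) * b₁ r - (r - y) * a r)^2)) := by positivity
    linarith
  have hle := hmono (left_mem_Icc.2 (by linarith)) (right_mem_Icc.2 (by linarith))
    (show y - h ≤ y + h by linarith)
  simp only [hB, show y - h - y = -h by ring, show y + h - y = h by ring] at hle
  have h3 : 0 < h ^ 3 := by positivity
  have : h^3 * (ω * q₀ * h^2 * (16 / 15)) ≤ h^3 * (20 * S) := by
    nlinarith
  have h5 := le_of_mul_le_mul_left this h3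
  have hS0 : 0 ≤ S := le_trans (by positivity) (hS y ⟨by linarith, by linarith⟩)
  nlinarith

lemma mul_sq_add_sq_le_of_hasDerivAt_system {a b a₁ b₁ μ : ℝ → ℝ} {ω x h S : ℝ} (hω : 0 ≤ ω)
    (hh : 0 < h)
    (ha : ∀ r ∈ Icc (x - 2 * h) (x + 2 * h), HasDerivAt a (a₁ r) r)
    (hb : ∀ r ∈ Icc (x - 2 * h) (x + 2 * h), HasDerivAt b (b₁ r) r)
    (ha₁ : ∀ r ∈ Icc (x - 2 * h) (x + 2 * h), HasDerivAt a₁ (μ r * a r - ω * b r) r)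
    (hb₁ : ∀ r ∈ Icc (x - 2 * h) (x + 2 * h), HasDerivAt b₁ (μ r * b r + ω * a r) r)
    (hμ : ∀ r ∈ Icc (x - 2 * h) (x + 2 * h), 0 ≤ μ r)
    (hS : ∀ r ∈ Icc (x - 2 * h) (x + 2 * h), a r ^ 2 + b r ^ 2 ≤ S) :
    ω * (a x ^ 2 + b x ^ 2) * h ^ 2 ≤ 20 * S := by
  set q : ℝ → ℝ := fun r => a r ^ 2 + b r ^ 2
  set q₁ : ℝ → ℝ := fun r => 2 * (a r * a₁ r + b r * b₁ r)
  have hq : ∀ r ∈ Icc (x - 2 * h) (x + 2 * h), HasDerivAt q (q₁ r) r := fun r hr => by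
    refine (((ha r hr).pow 2).add ((hb r hr).pow 2)).congr_deriv ?_
    simp only [q₁]; push_cast; ring
  have hq₁ : ∀ r ∈ Icc (x - 2 * h) (x + 2 * h), HasDerivAt q₁
      (2 * (a₁ r ^ 2 + b₁ r ^ 2 + μ r * (a r ^ 2 + b r ^ 2))) r := fun r hr => by
    refine ((((ha r hr).mul (ha₁ r hr)).add ((hb r hr).mul (hb₁ r hr))).const_mul 2).congr_deriv ?_
    ring
  have hmono : MonotoneOn q₁ (Icc (x - 2 * h) (x + 2 * h)) := by
    refine monotoneOn_of_deriv_nonneg (convex_Icc _ _)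
      (fun r hr => (hq₁ r hr).continuousAt.continuousWithinAt)
      (fun r hr => (hq₁ r (interior_subset hr)).differentiableAt.differentiableWithinAt)
      fun r hr => ?_
    have hr' := interior_subset hr
    rw [(hq₁ r hr').deriv]
    have := hμ r hr'
    positivity
  have hx : x ∈ Icc (x - 2 * h) (x + 2 * h) := ⟨by linarith, by linarith⟩
  rcases le_total 0 (q₁ x) with h0 | h0
  · have hsub : Icc x (x + 2 * h) ⊆ Icc (x - 2 * h) (x + 2 * h) := Icc_subset_Icc_left hx.1
    have hqm : MonotoneOn q (Icc x (x + 2 * h)) := by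
      refine monotoneOn_of_deriv_nonneg (convex_Icc _ _)
        (fun r hr => (hq r (hsub hr)).continuousAt.continuousWithinAt)
        (fun r hr => (hq r (hsub (interior_subset hr))).differentiableAt.differentiableWithinAt)
        fun r hr => ?_
      have hr' := interior_subset hr
      rw [(hq r (hsub hr')).deriv]
      exact h0.trans (hmono hx (hsub hr') hr'.1)
    have hsub' : Icc (x + h - h) (x + h + h) ⊆ Icc x (x + 2 * h) :=
      Icc_subset_Icc (by linarith) (by linarith)
    exact mul_le_of_hasDerivAt_system (y := x + h) hω hh
      (fun r hr => ha r (hsub (hsub' hr))) (fun r hr => hb r (hsub (hsub' hr)))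
      (fun r hr => ha₁ r (hsub (hsub' hr))) (fun r hr => hb₁ r (hsub (hsub' hr)))
      (fun r hr => hμ r (hsub (hsub' hr))) (fun r hr => hS r (hsub (hsub' hr)))
      (fun r hr => hqm (left_mem_Icc.2 (by linarith)) (hsub' hr) (hsub' hr).1)
  · have hsub : Icc (x - 2 * h) x ⊆ Icc (x - 2 * h) (x + 2 * h) := Icc_subset_Icc_right hx.2
    have hqm : AntitoneOn q (Icc (x - 2 * h) x) := by
      refine antitoneOn_of_deriv_nonpos (convex_Icc _ _)
        (fun r hr => (hq r (hsub hr)).continuousAt.continuousWithinAt)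
        (fun r hr => (hq r (hsub (interior_subset hr))).differentiableAt.differentiableWithinAt)
        fun r hr => ?_
      have hr' := interior_subset hr
      rw [(hq r (hsub hr')).deriv]
      exact (hmono (hsub hr') hx hr'.2).trans h0
    have hsub' : Icc (x - h - h) (x - h + h) ⊆ Icc (x - 2 * h) x :=
      Icc_subset_Icc (by linarith) (by linarith)
    exact mul_le_of_hasDerivAt_system (y := x - h) hω hh
      (fun r hr => ha r (hsub (hsub' hr))) (fun r hr => hb r (hsub (hsub' hr)))
      (fun r hr => ha₁ r (hsub (hsub' hr))) (fun r hr => hb₁ r (hsub (hsub' hr)))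
      (fun r hr => hμ r (hsub (hsub' hr))) (fun r hr => hS r (hsub (hsub' hr)))
      (fun r hr => hqm (hsub' hr) (right_mem_Icc.2 (by linarith)) (hsub' hr).2)

/-- Solutions of `w'' = (l + c) w` with `c ≥ 0` and `Re l ≥ 0` gain a factor `|Im l|⁻¹` in the
interior. -/
lemma abs_im_mul_norm_sq_le {w w₁ : ℝ → ℂ} {c : ℝ → ℝ} {l : ℂ} {x h S : ℝ} (hl : 0 ≤ l.re)
    (hh : 0 < h)
    (hw : ∀ r ∈ Icc (x - 2 * h) (x + 2 * h), HasDerivAt w (w₁ r) r)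
    (hw₁ : ∀ r ∈ Icc (x - 2 * h) (x + 2 * h), HasDerivAt w₁ ((l + c r) * w r) r)
    (hc : ∀ r ∈ Icc (x - 2 * h) (x + 2 * h), 0 ≤ c r)
    (hS : ∀ r ∈ Icc (x - 2 * h) (x + 2 * h), ‖w r‖ ^ 2 ≤ S) :
    |l.im| * ‖w x‖ ^ 2 * h ^ 2 ≤ 20 * S := by
  have hre : ∀ {f : ℝ → ℂ} {f' : ℂ} {r : ℝ}, HasDerivAt f f' r →
      HasDerivAt (fun r => (f r).re) f'.re r := fun hf =>
    Complex.reCLM.hasFDerivAt.comp_hasDerivAt _ hf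
  have him : ∀ {f : ℝ → ℂ} {f' : ℂ} {r : ℝ}, HasDerivAt f f' r →
      HasDerivAt (fun r => (f r).im) f'.im r := fun hf =>
    Complex.imCLM.hasFDerivAt.comp_hasDerivAt _ hf
  have hn : ∀ z : ℂ, ‖z‖ ^ 2 = z.re ^ 2 + z.im ^ 2 := fun z => by
    rw [Complex.sq_norm, Complex.normSq_apply]; ring
  have hμ : ∀ r ∈ Icc (x - 2 * h) (x + 2 * h), 0 ≤ l.re + c r := fun r hr =>
    add_nonneg hl (hc r hr)
  rw [hn]
  rcases le_total 0 l.im with h0 | h0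
  · rw [abs_of_nonneg h0]
    refine mul_sq_add_sq_le_of_hasDerivAt_system (μ := fun r => l.re + c r) h0 hh
      (fun r hr => hre (hw r hr)) (fun r hr => him (hw r hr))
      (fun r hr => (hre (hw₁ r hr)).congr_deriv ?_) (fun r hr => (him (hw₁ r hr)).congr_deriv ?_)
      hμ (fun r hr => (hn _).symm.trans_le (hS r hr)) <;> simp
  · rw [abs_of_nonpos h0]
    have := mul_sq_add_sq_le_of_hasDerivAt_system (μ := fun r => l.re + c r) (neg_nonneg.2 h0) hh
      (fun r hr => hre (hw r hr)) (fun r hr => (him (hw r hr)).neg)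
      (fun r hr => (hre (hw₁ r hr)).congr_deriv ?_)
      (fun r hr => (him (hw₁ r hr)).neg.congr_deriv ?_)
      hμ (S := S) (fun r hr => ?_)
    · simpa using this
    · simp
    · simp; ring
    · simpa using (hn _).symm.trans_le (hS r hr)

/-- The Laplace transform of a real function on `(0,∞)`, at a complex argument. -/
noncomputable def laplace (f : ℝ → ℝ) (z : ℂ) : ℂ :=
  ∫ τ in Set.Ioi (0:ℝ), Complex.exp (-z * τ) * f τ

lemma laplace_ofReal (f : ℝ → ℝ) (l : ℝ) :
    laplace f l = ((∫ τ in Set.Ioi (0:ℝ), Real.exp (-l * τ) * f τ : ℝ) : ℂ) := by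
  rw [laplace, ← integral_complex_ofReal]
  simp

/-- Functions on `(1,∞) × [0,∞)` that are continuous, and bounded for bounded first variable. -/
structure IsContinuousLocallyBounded (m : ℝ → ℝ → ℝ) : Prop where
  continuousOn : ContinuousOn (fun p : ℝ × ℝ => m p.1 p.2) (Ioi 1 ×ˢ Ici 0)
  bounded : ∀ b : ℝ, ∃ C : ℝ, ∀ r, 1 < r → r ≤ b → ∀ τ ≥ (0:ℝ), |m r τ| ≤ C

lemma norm_cexp_neg_mul (z : ℂ) (τ : ℝ) : ‖Complex.exp (-z * τ)‖ = Real.exp (-z.re * τ) := by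
  rw [Complex.norm_exp]; simp

lemma mul_exp_neg_le {b : ℝ} (hb : 0 < b) (τ : ℝ) :
    τ * Real.exp (-b * τ) ≤ 2 / b * Real.exp (-(b / 2) * τ) := by
  have h1 : b * τ / 2 ≤ Real.exp (b / 2 * τ) := by
    have := Real.add_one_le_exp (b / 2 * τ); linarith
  have h2 : Real.exp (-(b / 2) * τ) = Real.exp (b / 2 * τ) * Real.exp (-b * τ) := by
    rw [← Real.exp_add]; congr 1; ring
  rw [h2, ← mul_assoc]
  gcongr
  rw [div_mul_eq_mul_div, le_div_iff₀ hb]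
  linarith

namespace IsContinuousLocallyBounded

variable {m : ℝ → ℝ → ℝ}

lemma continuousOn_right (hm : IsContinuousLocallyBounded m) {r : ℝ} (hr : 1 < r) :
    ContinuousOn (m r) (Ici 0) :=
  hm.continuousOn.comp (f := fun τ : ℝ => (r, τ)) (by fun_prop) fun _ hτ => ⟨hr, hτ⟩

lemma continuousOn_left (hm : IsContinuousLocallyBounded m) {τ : ℝ} (hτ : 0 ≤ τ) :
    ContinuousOn (fun r => m r τ) (Ioi 1) :=
  hm.continuousOn.comp (f := fun r : ℝ => (r, τ)) (by fun_prop) fun _ hr => ⟨hr, hτ⟩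

lemma aestronglyMeasurable_mul (hm : IsContinuousLocallyBounded m) {r : ℝ} (hr : 1 < r)
    {g : ℝ → ℂ} (hg : Continuous g) :
    AEStronglyMeasurable (fun τ => g τ * (m r τ : ℂ)) (volume.restrict (Ioi 0)) :=
  (hg.continuousOn.mul (Complex.continuous_ofReal.comp_continuousOn
    ((hm.continuousOn_right hr).mono Ioi_subset_Ici_self))).aestronglyMeasurable measurableSet_Ioi

lemma norm_mul_le (z : ℂ) {C r τ : ℝ} (hC : |m r τ| ≤ C) :
    ‖Complex.exp (-z * τ) * (m r τ : ℂ)‖ ≤ Real.exp (-z.re * τ) * C := by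
  rw [norm_mul, norm_cexp_neg_mul, Complex.norm_real, Real.norm_eq_abs]
  gcongr

lemma norm_mul_le' {z : ℂ} {b C r τ : ℝ} (hb : 0 < b) (hz : b ≤ z.re) (hτ : 0 ≤ τ)
    (hC : |m r τ| ≤ C) :
    ‖-τ * Complex.exp (-z * τ) * (m r τ : ℂ)‖ ≤ 2 / b * Real.exp (-(b / 2) * τ) * C := by
  rw [norm_mul, norm_mul, norm_cexp_neg_mul, Complex.norm_real, Real.norm_eq_abs, norm_neg,
    Complex.norm_real, Real.norm_of_nonneg hτ]
  have : τ * Real.exp (-z.re * τ) ≤ 2 / b * Real.exp (-(b / 2) * τ) := by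
    refine le_trans ?_ (mul_exp_neg_le hb τ)
    gcongr
  gcongr

lemma integrableOn (hm : IsContinuousLocallyBounded m) {r : ℝ} (hr : 1 < r) {z : ℂ}
    (hz : 0 < z.re) :
    IntegrableOn (fun τ : ℝ => Complex.exp (-z * τ) * (m r τ : ℂ)) (Ioi 0) := by
  obtain ⟨C, hC⟩ := hm.bounded r
  refine Integrable.mono' ((exp_neg_integrableOn_Ioi 0 hz).mul_const C)
    (hm.aestronglyMeasurable_mul hr (by fun_prop)) ?_
  refine (ae_restrict_iff' measurableSet_Ioi).2 (Eventually.of_forall fun τ hτ => ?_)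
  exact norm_mul_le z (hC r hr le_rfl τ (le_of_lt hτ))

lemma norm_laplace_le (hm : IsContinuousLocallyBounded m) (b : ℝ) :
    ∃ C, ∀ r, 1 < r → r ≤ b → ∀ z : ℂ, z.re = 1 → ‖laplace (m r) z‖ ≤ C := by
  obtain ⟨C, hC⟩ := hm.bounded b
  refine ⟨∫ τ in Ioi (0:ℝ), Real.exp (-1 * τ) * C, fun r hr hrb z hz => ?_⟩
  refine norm_integral_le_of_norm_le ((exp_neg_integrableOn_Ioi 0 one_pos).mul_const C) ?_
  refine (ae_restrict_iff' measurableSet_Ioi).2 (Eventually.of_forall fun τ hτ => ?_)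
  have := norm_mul_le z (hC r hr hrb τ (le_of_lt hτ))
  rwa [hz] at this

lemma hasDerivAt_laplace (hm : IsContinuousLocallyBounded m) {r : ℝ} (hr : 1 < r) {z : ℂ}
    (hz : 0 < z.re) :
    HasDerivAt (laplace (m r)) (∫ τ in Ioi (0:ℝ), -τ * Complex.exp (-z * τ) * (m r τ : ℂ)) z := by
  obtain ⟨C, hC⟩ := hm.bounded r
  set b := z.re / 2 with hb
  have hb0 : 0 < b := by positivity
  refine (hasDerivAt_integral_of_dominated_loc_of_deriv_le
    (μ := volume.restrict (Ioi (0:ℝ))) (x₀ := z) (s := {z : ℂ | b < z.re})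
    (F := fun z τ => Complex.exp (-z * τ) * (m r τ : ℂ))
    (F' := fun z τ => -τ * Complex.exp (-z * τ) * (m r τ : ℂ))
    (bound := fun τ => 2 / b * Real.exp (-(b / 2) * τ) * C)
    ((isOpen_lt continuous_const Complex.continuous_re).mem_nhds (by simp [hb]; linarith))
    (Eventually.of_forall fun z => hm.aestronglyMeasurable_mul hr (by fun_prop))
    (hm.integrableOn hr hz) (hm.aestronglyMeasurable_mul hr (by fun_prop)) ?_
    (((exp_neg_integrableOn_Ioi 0 (half_pos hb0)).const_mul _).mul_const C) ?_).2
  · refine (ae_restrict_iff' measurableSet_Ioi).2 (Eventually.of_forall fun τ hτ y hy => ?_)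
    exact norm_mul_le' hb0 (le_of_lt hy) (le_of_lt hτ) (hC r hr le_rfl τ (le_of_lt hτ))
  · refine Eventually.of_forall fun τ y _ => ?_
    have h1 : HasDerivAt (fun y : ℂ => -y * τ) (-(τ:ℂ)) y := by
      simpa using ((hasDerivAt_id y).neg.mul_const (τ:ℂ))
    refine (h1.cexp.mul_const (m r τ : ℂ)).congr_deriv ?_
    ring

lemma continuousOn_integral (hm : IsContinuousLocallyBounded m) {g : ℝ → ℂ} (hg : Continuous g)
    (hgi : IntegrableOn g (Ioi 0)) :
    ContinuousOn (fun r => ∫ τ in Ioi (0:ℝ), g τ * (m r τ : ℂ)) (Ioi 1) := by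
  intro r hr
  have hr1 : (1:ℝ) < r := hr
  refine ContinuousAt.continuousWithinAt ?_
  obtain ⟨C, hC⟩ := hm.bounded (r + 1)
  have hev : ∀ᶠ x in nhds r, 1 < x ∧ x < r + 1 := Ioo_mem_nhds hr1 (by linarith)
  refine continuousAt_of_dominated (bound := fun τ => ‖g τ‖ * C) ?_ ?_ (hgi.norm.mul_const C) ?_
  · filter_upwards [hev] with x hx
    exact hm.aestronglyMeasurable_mul hx.1 hg
  · filter_upwards [hev] with x hx
    refine (ae_restrict_iff' measurableSet_Ioi).2 (Eventually.of_forall fun τ hτ => ?_)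
    rw [norm_mul, Complex.norm_real]
    exact mul_le_mul_of_nonneg_left (hC x hx.1 hx.2.le τ (le_of_lt hτ)) (norm_nonneg _)
  · refine (ae_restrict_iff' measurableSet_Ioi).2 (Eventually.of_forall fun τ hτ => ?_)
    refine continuousAt_const.mul (Complex.continuous_ofReal.continuousAt.comp ?_)
    exact (hm.continuousOn_left (le_of_lt hτ)).continuousAt (Ioi_mem_nhds hr1)

lemma integrableOn_cexp {z : ℂ} (hz : 0 < z.re) :
    IntegrableOn (fun τ : ℝ => Complex.exp (-z * τ)) (Ioi 0) := by
  refine Integrable.mono' (exp_neg_integrableOn_Ioi 0 hz)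
    (Continuous.aestronglyMeasurable (by fun_prop)) (Eventually.of_forall fun τ => ?_)
  exact (norm_cexp_neg_mul z τ).le

lemma integrableOn_mul_cexp {z : ℂ} (hz : 0 < z.re) :
    IntegrableOn (fun τ : ℝ => -τ * Complex.exp (-z * τ)) (Ioi 0) := by
  refine Integrable.mono' ((exp_neg_integrableOn_Ioi 0 (half_pos hz)).const_mul (2 / z.re))
    (Continuous.aestronglyMeasurable (by fun_prop)) ?_
  refine (ae_restrict_iff' measurableSet_Ioi).2 (Eventually.of_forall fun τ hτ => ?_)
  simpa using norm_mul_le' (m := fun _ _ => 1) (r := 0) (C := 1) hz le_rfl (le_of_lt hτ) (by simp)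

lemma continuousOn_laplace (hm : IsContinuousLocallyBounded m) {z : ℂ} (hz : 0 < z.re) :
    ContinuousOn (fun r => laplace (m r) z) (Ioi 1) :=
  hm.continuousOn_integral (by fun_prop) (integrableOn_cexp hz)

lemma differentiableOn_integral_laplace (hm : IsContinuousLocallyBounded m) {k : ℝ → ℂ}
    (hk : ContinuousOn k (Ioi 1)) {p q : ℝ} (hp : 1 < p) (hq : 1 < q) :
    DifferentiableOn ℂ (fun z => ∫ ρ in p..q, k ρ * laplace (m ρ) z) {z | 0 < z.re} := by
  intro z hz
  have hz0 : 0 < z.re := hz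
  refine DifferentiableAt.differentiableWithinAt ?_
  have hsub : uIcc p q ⊆ Ioi 1 := fun x hx => (lt_min hp hq).trans_le hx.1
  have hsub' : Set.uIoc p q ⊆ Ioi 1 := uIoc_subset_uIcc.trans hsub
  obtain ⟨C, hC⟩ := hm.bounded (max p q)
  set b := z.re / 2 with hb
  have hb0 : 0 < b := by positivity
  set D := ∫ τ in Ioi (0:ℝ), 2 / b * Real.exp (-(b / 2) * τ) * C
  refine (intervalIntegral.hasDerivAt_integral_of_dominated_loc_of_deriv_le
    (μ := volume) (x₀ := z) (s := {z : ℂ | b < z.re}) (a := p) (b := q)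
    (F := fun z ρ => k ρ * laplace (m ρ) z)
    (F' := fun z ρ => k ρ * ∫ τ in Ioi (0:ℝ), -τ * Complex.exp (-z * τ) * (m ρ τ : ℂ))
    (bound := fun ρ => ‖k ρ‖ * D)
    ((isOpen_lt continuous_const Complex.continuous_re).mem_nhds (by simp [hb]; linarith))
    ?_ ?_ ?_ ?_ ?_ ?_).2.differentiableAt
  · filter_upwards [(isOpen_lt continuous_const Complex.continuous_re).mem_nhds hz] with y hy
    exact ((hk.mul (hm.continuousOn_laplace hy)).mono hsub').aestronglyMeasurable
      measurableSet_uIoc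
  · exact ((hk.mul (hm.continuousOn_laplace hz)).mono hsub).intervalIntegrable
  · exact ((hk.mul (hm.continuousOn_integral (by fun_prop)
      (integrableOn_mul_cexp hz))).mono hsub').aestronglyMeasurable measurableSet_uIoc
  · refine Eventually.of_forall fun ρ hρ y hy => ?_
    rw [norm_mul]
    gcongr
    refine norm_integral_le_of_norm_le
      (((exp_neg_integrableOn_Ioi 0 (half_pos hb0)).const_mul _).mul_const C) ?_
    refine (ae_restrict_iff' measurableSet_Ioi).2 (Eventually.of_forall fun τ hτ => ?_)
    exact norm_mul_le' hb0 (le_of_lt hy) (le_of_lt hτ) (hC ρ (hsub' hρ) hρ.2 τ (le_of_lt hτ))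
  · exact ((hk.mono hsub).norm.mul continuousOn_const).intervalIntegrable
  · refine Eventually.of_forall fun ρ hρ y hy => ?_
    exact (hm.hasDerivAt_laplace (hsub' hρ) (hb0.trans hy)).const_mul (k ρ)

end IsContinuousLocallyBounded

lemma eq_add_integral_of_hasDerivAt_twice {f f₁ f₂ : ℝ → ℂ} {p q : ℝ}
    (hf : ∀ r ∈ uIcc p q, HasDerivAt f (f₁ r) r) (hf₁ : ∀ r ∈ uIcc p q, HasDerivAt f₁ (f₂ r) r)
    (hf₂ : ContinuousOn f₂ (uIcc p q)) :
    f q = f p + (q - p) * f₁ p + ∫ ρ in p..q, ((q:ℂ) - ρ) * f₂ ρ := by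
  have key := intervalIntegral.integral_eq_sub_of_hasDerivAt (a := p) (b := q)
    (f := fun ρ => ((q:ℂ) - ρ) * f₁ ρ + f ρ) (f' := fun ρ => ((q:ℂ) - ρ) * f₂ ρ) ?_ ?_
  · rw [key]; ring
  · intro r hr
    have h1 : HasDerivAt (fun ρ : ℝ => (q:ℂ) - ρ) (-1) r := by
      simpa using ((hasDerivAt_id r).ofReal_comp).const_sub (q:ℂ)
    refine ((h1.mul (hf₁ r hr)).add (hf r hr)).congr_deriv ?_
    ring
  · exact ((Continuous.continuousOn (by fun_prop)).mul hf₂).intervalIntegrable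

section ODE

variable {m : ℝ → ℝ → ℝ} {c : ℝ}

/-- The coefficient `2z + c/r²`. -/
noncomputable def potential (c : ℝ) (z : ℂ) (r : ℝ) : ℂ := 2 * z + (c / r^2 : ℝ)

lemma continuousOn_potential (c : ℝ) (z : ℂ) : ContinuousOn (potential c z) (Ioi 1) := by
  refine continuousOn_const.add (Complex.continuous_ofReal.comp_continuousOn ?_)
  refine continuousOn_const.div (by fun_prop) fun r hr => ?_
  have : (1:ℝ) < r := hr
  positivity

/-- The Laplace transform of `m` solves `w'' = (2l + c/r²) w` for positive real `l`. -/
def LaplaceSolvesODE (m : ℝ → ℝ → ℝ) (c : ℝ) : Prop :=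
  ∀ l > (0:ℝ), ∃ w₁ : ℝ → ℝ, ∀ r > (1:ℝ),
    HasDerivAt (fun r => ∫ τ in Set.Ioi (0:ℝ), Real.exp (-l * τ) * m r τ) (w₁ r) r ∧
    HasDerivAt w₁ ((2 * l + c / r^2) * ∫ τ in Set.Ioi (0:ℝ), Real.exp (-l * τ) * m r τ) r

/-- The remainder `w(r) - w(2) - ∫₂ʳ (r - ρ) w''(ρ) dρ` when `w'' = (2z + c/ρ²) w`. -/
noncomputable def odeRemainder (m : ℝ → ℝ → ℝ) (c : ℝ) (r : ℝ) (z : ℂ) : ℂ :=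
  laplace (m r) z - laplace (m 2) z
    - ∫ ρ in (2:ℝ)..r, ((r:ℂ) - ρ) * (potential c z ρ * laplace (m ρ) z)

lemma differentiableOn_integral_potential (hm : IsContinuousLocallyBounded m) {k : ℝ → ℂ}
    (hk : Continuous k) {r : ℝ} (hr : 1 < r) :
    DifferentiableOn ℂ (fun z => ∫ ρ in (2:ℝ)..r, k ρ * (potential c z ρ * laplace (m ρ) z))
      {z | 0 < z.re} := by
  have hk2 : ContinuousOn (fun ρ => k ρ * ((c / ρ^2 : ℝ) : ℂ)) (Ioi 1) :=
    hk.continuousOn.mul ((continuousOn_potential c 0).congr fun ρ _ => by simp [potential])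
  have d1 := hm.differentiableOn_integral_laplace hk.continuousOn one_lt_two hr
  have d2 := hm.differentiableOn_integral_laplace hk2 one_lt_two hr
  have hsub : uIcc 2 r ⊆ Ioi 1 := fun x hx => (lt_min one_lt_two hr).trans_le hx.1
  refine (((differentiableOn_id.const_mul 2).mul d1).add d2).congr fun z hz => ?_
  have i1 : IntervalIntegrable (fun ρ => k ρ * laplace (m ρ) z) volume 2 r :=
    ((hk.continuousOn.mul (hm.continuousOn_laplace hz)).mono hsub).intervalIntegrable
  have i2 : IntervalIntegrable (fun ρ => k ρ * ((c / ρ^2 : ℝ) : ℂ) * laplace (m ρ) z) volume 2 r :=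
    ((hk2.mul (hm.continuousOn_laplace hz)).mono hsub).intervalIntegrable
  simp only [Pi.add_apply, Pi.mul_apply, id]
  rw [← intervalIntegral.integral_const_mul, ← intervalIntegral.integral_add (i1.const_mul _) i2]
  refine intervalIntegral.integral_congr fun ρ _ => ?_
  simp only [potential]
  ring

lemma differentiableOn_laplace (hm : IsContinuousLocallyBounded m) {r : ℝ} (hr : 1 < r) :
    DifferentiableOn ℂ (laplace (m r)) {z | 0 < z.re} := fun _ hz =>
  (hm.hasDerivAt_laplace hr hz).differentiableAt.differentiableWithinAt

lemma differentiableOn_odeRemainder (hm : IsContinuousLocallyBounded m) {r : ℝ} (hr : 1 < r) :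
    DifferentiableOn ℂ (odeRemainder m c r) {z | 0 < z.re} :=
  ((differentiableOn_laplace hm hr).sub (differentiableOn_laplace hm one_lt_two)).sub
    (differentiableOn_integral_potential hm (by fun_prop) hr)

lemma odeRemainder_eq (hm : IsContinuousLocallyBounded m) (hode : LaplaceSolvesODE m c) {r : ℝ}
    (hr : 1 < r) {z : ℂ} (hz : 0 < z.re) :
    odeRemainder m c r z = (r - 2) * odeRemainder m c 3 z := by
  have hopen : IsOpen {z : ℂ | 0 < z.re} := isOpen_lt continuous_const Complex.continuous_re
  have hd : DifferentiableOn ℂ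
      (fun z => odeRemainder m c r z - (r - 2) * odeRemainder m c 3 z) {z | 0 < z.re} :=
    (differentiableOn_odeRemainder hm hr).sub
      ((differentiableOn_odeRemainder hm (by norm_num)).const_mul _)
  have hreal : ∀ l : ℝ, 0 < l →
      odeRemainder m c r l - (r - 2) * odeRemainder m c 3 l = 0 := by
    intro l hl
    obtain ⟨w₁, hw⟩ := hode l hl
    have hR : ∀ x : ℝ, 1 < x → odeRemainder m c x l = (x - 2) * w₁ 2 := by
      intro x hx
      have hsub : uIcc 2 x ⊆ Ioi 1 := fun y hy => (lt_min one_lt_two hx).trans_le hy.1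
      have := eq_add_integral_of_hasDerivAt_twice (p := 2) (q := x)
        (f := fun r => laplace (m r) l) (f₁ := fun r => (w₁ r : ℂ))
        (f₂ := fun r => potential c l r * laplace (m r) l)
        (fun y hy => by
          simp only [laplace_ofReal]
          exact (hw y (hsub hy)).1.ofReal_comp)
        (fun y hy => by
          refine ((hw y (hsub hy)).2.ofReal_comp).congr_deriv ?_
          simp only [laplace_ofReal, potential]
          push_cast
          ring)
        (((continuousOn_potential c l).mul (hm.continuousOn_laplace (by simpa using hl))).mono hsub)
      rw [odeRemainder, this]
      push_cast
      ring
    rw [hR r hr, hR 3 (by norm_num)]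
    push_cast
    ring
  have hfreq : ∃ᶠ z in nhdsWithin (1:ℂ) {1}ᶜ,
      odeRemainder m c r z - (r - 2) * odeRemainder m c 3 z = 0 := by
    have ht : Tendsto (fun x : ℝ => (x : ℂ)) (nhdsWithin 1 {1}ᶜ) (nhdsWithin (1:ℂ) {1}ᶜ) := by
      refine tendsto_nhdsWithin_iff.2 ⟨?_, ?_⟩
      · exact (Complex.continuous_ofReal.tendsto' 1 1 (by simp)).mono_left nhdsWithin_le_nhds
      · filter_upwards [self_mem_nhdsWithin] with x hx
        simpa using hx
    refine ht.frequently (Eventually.frequently ?_)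
    filter_upwards [nhdsWithin_le_nhds (lt_mem_nhds one_pos)] with x hx
    exact hreal x hx
  have := (hd.analyticOnNhd hopen).eqOn_zero_of_preconnected_of_frequently_eq_zero
    (convex_halfSpace_re_gt 0).isPreconnected (by simp) hfreq hz
  exact sub_eq_zero.1 this

/-- The first derivative in `r` of `laplace (m r) z`. -/
noncomputable def laplaceDeriv (m : ℝ → ℝ → ℝ) (c : ℝ) (r : ℝ) (z : ℂ) : ℂ :=
  odeRemainder m c 3 z + ∫ ρ in (2:ℝ)..r, potential c z ρ * laplace (m ρ) z

lemma differentiableOn_laplaceDeriv (hm : IsContinuousLocallyBounded m) {r : ℝ} (hr : 1 < r) :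
    DifferentiableOn ℂ (laplaceDeriv m c r) {z | 0 < z.re} := by
  refine (differentiableOn_odeRemainder hm (by norm_num)).add ?_
  simpa using differentiableOn_integral_potential (c := c) hm (k := fun _ => 1) (by fun_prop) hr

lemma hasDerivAt_integral_of_continuousOn_Ioi {F : ℝ → ℂ} (hF : ContinuousOn F (Ioi 1)) {r : ℝ}
    (hr : 1 < r) : HasDerivAt (fun r => ∫ ρ in (2:ℝ)..r, F ρ) (F r) r :=
  intervalIntegral.integral_hasDerivAt_right
    ((hF.mono fun _ hx => (lt_min one_lt_two hr).trans_le hx.1).intervalIntegrable)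
    (hF.stronglyMeasurableAtFilter isOpen_Ioi r hr) (hF.continuousAt (Ioi_mem_nhds hr))

lemma hasDerivAt_laplaceDeriv (hm : IsContinuousLocallyBounded m) {r : ℝ} (hr : 1 < r) {z : ℂ}
    (hz : 0 < z.re) :
    HasDerivAt (fun r => laplaceDeriv m c r z) (potential c z r * laplace (m r) z) r :=
  (hasDerivAt_integral_of_continuousOn_Ioi
    ((continuousOn_potential c z).mul (hm.continuousOn_laplace hz)) hr).const_add _

lemma hasDerivAt_laplace_left (hm : IsContinuousLocallyBounded m) (hode : LaplaceSolvesODE m c)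
    {r : ℝ} (hr : 1 < r) {z : ℂ} (hz : 0 < z.re) :
    HasDerivAt (fun r => laplace (m r) z) (laplaceDeriv m c r z) r := by
  have hF : ContinuousOn (fun ρ => potential c z ρ * laplace (m ρ) z) (Ioi 1) :=
    (continuousOn_potential c z).mul (hm.continuousOn_laplace hz)
  have hF' : ContinuousOn (fun ρ : ℝ => (ρ:ℂ) * (potential c z ρ * laplace (m ρ) z)) (Ioi 1) :=
    (Complex.continuous_ofReal.continuousOn).mul hF
  have heq : ∀ x : ℝ, 1 < x → laplace (m x) z = laplace (m 2) z + (x - 2) * odeRemainder m c 3 z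
      + (x * (∫ ρ in (2:ℝ)..x, potential c z ρ * laplace (m ρ) z)
        - ∫ ρ in (2:ℝ)..x, (ρ:ℂ) * (potential c z ρ * laplace (m ρ) z)) := by
    intro x hx
    have hsub : uIcc 2 x ⊆ Ioi 1 := fun y hy => (lt_min one_lt_two hx).trans_le hy.1
    rw [← odeRemainder_eq hm hode hx hz, ← intervalIntegral.integral_const_mul,
      ← intervalIntegral.integral_sub ((hF.mono hsub).intervalIntegrable.const_mul _)
        (hF'.mono hsub).intervalIntegrable, odeRemainder]
    simp only [sub_mul]
    ring
  have hx : HasDerivAt (fun x : ℝ => (x:ℂ)) 1 r := by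
    simpa using (hasDerivAt_id r).ofReal_comp
  have hd := ((hx.sub_const 2).mul_const (odeRemainder m c 3 z)).const_add (laplace (m 2) z)
    |>.add ((hx.mul (hasDerivAt_integral_of_continuousOn_Ioi hF hr)).sub
      (hasDerivAt_integral_of_continuousOn_Ioi hF' hr))
  refine (hd.congr_of_eventuallyEq ?_).congr_deriv ?_
  · filter_upwards [lt_mem_nhds hr] with x hx1
    exact heq x hx1
  · simp only [laplaceDeriv]
    ring

end ODE

section Decay

variable {m : ℝ → ℝ → ℝ} {c : ℝ}

/-- The vertical line `Re z = 1`, parametrised by frequency. -/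
noncomputable def vertical (ξ : ℝ) : ℂ := 1 + (2 * π * ξ : ℝ) * Complex.I

@[simp] lemma vertical_re (ξ : ℝ) : (vertical ξ).re = 1 := by
  simp [vertical]

@[simp] lemma vertical_im (ξ : ℝ) : (vertical ξ).im = 2 * π * ξ := by
  simp [vertical]

lemma abs_le_abs_vertical_im (ξ : ℝ) : |ξ| ≤ |(vertical ξ).im| := by
  rw [vertical_im, abs_mul, abs_of_pos (by positivity : (0:ℝ) < 2 * π)]
  nlinarith [pi_gt_three, abs_nonneg ξ]

lemma norm_vertical_le (ξ : ℝ) : ‖vertical ξ‖ ≤ 7 * (1 + |ξ|) := by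
  refine (Complex.norm_le_abs_re_add_abs_im _).trans ?_
  rw [vertical_re, vertical_im, abs_mul, abs_of_pos (by positivity : (0:ℝ) < 2 * π), abs_one]
  nlinarith [pi_lt_d2, abs_nonneg ξ]

lemma norm_potential_le {ξ r : ℝ} (hr : 1 ≤ r) :
    ‖potential c (vertical ξ) r‖ ≤ (14 + |c|) * (1 + |ξ|) := by
  have h1 : ‖((c / r^2 : ℝ) : ℂ)‖ ≤ |c| := by
    rw [Complex.norm_real, Real.norm_eq_abs, abs_div, abs_of_pos (by positivity : 0 < r^2)]
    exact div_le_self (abs_nonneg _) (one_le_pow₀ hr)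
  refine (norm_add_le _ _).trans ?_
  rw [norm_mul, Complex.norm_ofNat]
  nlinarith [norm_vertical_le ξ, abs_nonneg ξ, mul_nonneg (abs_nonneg c) (abs_nonneg ξ)]

lemma exists_abs_pow_mul_norm_laplace_sq_le (hm : IsContinuousLocallyBounded m)
    (hode : LaplaceSolvesODE m c) (hc : 0 ≤ c) (n : ℕ) :
    ∀ a b : ℝ, 1 < a → ∃ C, ∀ ξ : ℝ, ∀ r ∈ Icc a b,
      |ξ| ^ n * ‖laplace (m r) (vertical ξ)‖ ^ 2 ≤ C := by
  induction n with
  | zero =>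
    intro a b ha
    obtain ⟨C, hC⟩ := hm.norm_laplace_le b
    refine ⟨C ^ 2, fun ξ r hr => ?_⟩
    rw [pow_zero, one_mul]
    gcongr
    exact hC r (ha.trans_le hr.1) hr.2 _ (vertical_re ξ)
  | succ n ih =>
    intro a b ha
    obtain ⟨C, hC⟩ := ih ((1 + a) / 2) (b + (a - 1) / 2) (by linarith)
    set h := (a - 1) / 4 with hh
    have h0 : 0 < h := by rw [hh]; linarith
    refine ⟨20 * C / h ^ 2, fun ξ r hr => ?_⟩
    rw [le_div_iff₀ (by positivity)]
    rcases eq_or_ne ξ 0 with rfl | hξ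
    · have := hC 0 r ⟨by linarith [hr.1], by linarith [hr.2]⟩
      have : 0 ≤ C := le_trans (by positivity) this
      simp; linarith
    have hξ' : 0 < |ξ| ^ n := by positivity
    have hmem : ∀ x ∈ Icc (r - 2 * h) (r + 2 * h), x ∈ Icc ((1 + a) / 2) (b + (a - 1) / 2) :=
      fun x hx => ⟨by linarith [hx.1, hr.1], by linarith [hx.2, hr.2]⟩
    have hgt : ∀ x ∈ Icc (r - 2 * h) (r + 2 * h), 1 < x := fun x hx => by
      linarith [(hmem x hx).1]
    have key := abs_im_mul_norm_sq_le (w := fun x => laplace (m x) (vertical ξ))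
      (w₁ := fun x => laplaceDeriv m c x (vertical ξ)) (c := fun x => c / x ^ 2)
      (l := 2 * vertical ξ) (x := r) (h := h) (S := C / |ξ| ^ n) (by simp) h0
      (fun x hx => hasDerivAt_laplace_left hm hode (hgt x hx) (by simp))
      (fun x hx => hasDerivAt_laplaceDeriv hm (hgt x hx) (by simp))
      (fun x hx => by positivity)
      (fun x hx => by
        rw [le_div_iff₀ hξ', mul_comm]
        exact hC ξ x (hmem x hx))
    have him : |ξ| ≤ |(2 * vertical ξ).im| := by
      have := abs_le_abs_vertical_im ξ
      simp only [Complex.mul_im, Complex.re_ofNat, Complex.im_ofNat, zero_mul, add_zero, abs_mul]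
      norm_num
      simp at this
      linarith [abs_nonneg ξ, abs_nonneg (π * ξ)]
    have : |ξ| * ‖laplace (m r) (vertical ξ)‖ ^ 2 * h ^ 2 ≤ 20 * (C / |ξ| ^ n) :=
      le_trans (by gcongr) key
    rw [mul_div_assoc', le_div_iff₀ hξ'] at this
    calc _ = |ξ| * ‖laplace (m r) (vertical ξ)‖ ^ 2 * h ^ 2 * |ξ| ^ n := by ring
      _ ≤ _ := this

lemma exists_one_add_abs_mul_norm_laplace_le (hm : IsContinuousLocallyBounded m)
    (hode : LaplaceSolvesODE m c) (hc : 0 ≤ c) {a : ℝ} (b : ℝ) (ha : 1 < a) :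
    ∃ C, 0 ≤ C ∧ ∀ ξ : ℝ, ∀ r ∈ Icc a b,
      (1 + |ξ|) * ‖laplace (m r) (vertical ξ)‖ ≤ C * (1 + ξ ^ 2)⁻¹ := by
  obtain ⟨C₀, h₀⟩ := exists_abs_pow_mul_norm_laplace_sq_le hm hode hc 0 a b ha
  obtain ⟨C₆, h₆⟩ := exists_abs_pow_mul_norm_laplace_sq_le hm hode hc 6 a b ha
  refine ⟨√(32 * (C₀ + C₆)), sqrt_nonneg _, fun ξ r hr => ?_⟩
  rw [← div_eq_mul_inv, le_div_iff₀ (by positivity)]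
  refine le_sqrt_of_sq_le ?_
  have h1 := h₀ ξ r hr
  have h2 := h₆ ξ r hr
  set y := |ξ| with hy
  have hy0 : 0 ≤ y := abs_nonneg ξ
  rw [← sq_abs ξ, ← hy]
  have hpoly : ((1 + y) * (1 + y ^ 2)) ^ 2 ≤ 32 * (1 + y ^ 6) := by
    have e1 : (1 + y) ^ 2 ≤ 2 * (1 + y ^ 2) := by nlinarith [sq_nonneg (1 - y)]
    have e2 : (1 + y ^ 2) ^ 3 ≤ 4 * (1 + y ^ 6) := by
      nlinarith [mul_nonneg (sq_nonneg (1 - y ^ 2)) (by positivity : 0 ≤ 1 + y ^ 2)]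
    calc ((1 + y) * (1 + y ^ 2)) ^ 2 = (1 + y) ^ 2 * (1 + y ^ 2) ^ 2 := by ring
      _ ≤ 2 * (1 + y ^ 2) * (1 + y ^ 2) ^ 2 := by gcongr
      _ = 2 * (1 + y ^ 2) ^ 3 := by ring
      _ ≤ 32 * (1 + y ^ 6) := by nlinarith [pow_nonneg hy0 6]
  calc ((1 + y) * ‖laplace (m r) (vertical ξ)‖ * (1 + y ^ 2)) ^ 2
      = ((1 + y) * (1 + y ^ 2)) ^ 2 * ‖laplace (m r) (vertical ξ)‖ ^ 2 := by ring
    _ ≤ 32 * (1 + y ^ 6) * ‖laplace (m r) (vertical ξ)‖ ^ 2 := by gcongr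
    _ ≤ 32 * (C₀ + C₆) := by linarith

/-- All the kernels occurring in the inverse Laplace integrals decay quadratically in the
frequency, locally uniformly in `r`. -/
lemma exists_norm_le_inv_one_add_sq (hm : IsContinuousLocallyBounded m)
    (hode : LaplaceSolvesODE m c) (hc : 0 ≤ c) {a : ℝ} (b : ℝ) (ha : 1 < a) :
    ∃ C, ∀ ξ : ℝ, ∀ r ∈ Icc a b,
      ‖laplace (m r) (vertical ξ)‖ ≤ C * (1 + ξ ^ 2)⁻¹ ∧
      ‖vertical ξ * laplace (m r) (vertical ξ)‖ ≤ C * (1 + ξ ^ 2)⁻¹ ∧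
      ‖potential c (vertical ξ) r * laplace (m r) (vertical ξ)‖ ≤ C * (1 + ξ ^ 2)⁻¹ ∧
      ‖laplaceDeriv m c r (vertical ξ)‖ ≤ C * (1 + ξ ^ 2)⁻¹ := by
  obtain ⟨C, hC0, hC⟩ := exists_one_add_abs_mul_norm_laplace_le hm hode hc (b + 1) ha
  have hV : ∀ ξ : ℝ, ∀ r ∈ Icc a (b + 1),
      ‖potential c (vertical ξ) r * laplace (m r) (vertical ξ)‖
        ≤ (14 + |c|) * (C * (1 + ξ ^ 2)⁻¹) := by
    intro ξ r hr
    rw [norm_mul]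
    calc _ ≤ (14 + |c|) * (1 + |ξ|) * ‖laplace (m r) (vertical ξ)‖ := by
          gcongr
          exact norm_potential_le (ha.trans_le hr.1).le
      _ = (14 + |c|) * ((1 + |ξ|) * ‖laplace (m r) (vertical ξ)‖) := by ring
      _ ≤ _ := mul_le_mul_of_nonneg_left (hC ξ r hr) (by positivity)
  have hW : ∀ ξ : ℝ, ∀ r ∈ Icc a (b + 1),
      ‖laplace (m r) (vertical ξ)‖ ≤ C * (1 + ξ ^ 2)⁻¹ := by
    intro ξ r hr
    refine le_trans ?_ (hC ξ r hr)
    exact le_mul_of_one_le_left (norm_nonneg _) (by linarith [abs_nonneg ξ])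
  refine ⟨(16 + |c|) * C, fun ξ r hr => ?_⟩
  have hr' : r ∈ Icc a (b + 1) := ⟨hr.1, by linarith [hr.2]⟩
  have hr1 : r + 1 ∈ Icc a (b + 1) := ⟨by linarith [hr.1], by linarith [hr.2]⟩
  set B := C * (1 + ξ ^ 2)⁻¹ with hB
  have hB0 : 0 ≤ B := by positivity
  have hcB : 0 ≤ |c| * B := by positivity
  rw [mul_assoc (16 + |c|), ← hB]
  refine ⟨by linarith [hW ξ r hr'], ?_, by linarith [hV ξ r hr'], ?_⟩
  · rw [norm_mul]
    have : ‖vertical ξ‖ * ‖laplace (m r) (vertical ξ)‖ ≤ 7 * B := by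
      calc _ ≤ 7 * (1 + |ξ|) * ‖laplace (m r) (vertical ξ)‖ := by
            gcongr
            exact norm_vertical_le ξ
        _ = 7 * ((1 + |ξ|) * ‖laplace (m r) (vertical ξ)‖) := by ring
        _ ≤ _ := by gcongr; exact hC ξ r hr'
    linarith
  · have hle : r ≤ r + 1 := by linarith
    have hmem : ∀ x ∈ uIcc r (r + 1), x ∈ Icc a (b + 1) := fun x hx => by
      rw [uIcc_of_le hle] at hx
      exact ⟨hr.1.trans hx.1, hx.2.trans hr1.2⟩
    have hgt : ∀ x ∈ uIcc r (r + 1), 1 < x := fun x hx => ha.trans_le (hmem x hx).1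
    have key := eq_add_integral_of_hasDerivAt_twice (p := r) (q := r + 1)
      (f := fun x => laplace (m x) (vertical ξ)) (f₁ := fun x => laplaceDeriv m c x (vertical ξ))
      (f₂ := fun x => potential c (vertical ξ) x * laplace (m x) (vertical ξ))
      (fun x hx => hasDerivAt_laplace_left hm hode (hgt x hx) (by simp))
      (fun x hx => hasDerivAt_laplaceDeriv hm (hgt x hx) (by simp))
      (((continuousOn_potential c _).mul (hm.continuousOn_laplace (by simp))).mono
        fun x hx => hgt x hx)
    have hint : ‖∫ ρ in r..(r + 1), (((r + 1 : ℝ) : ℂ) - ρ)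
        * (potential c (vertical ξ) ρ * laplace (m ρ) (vertical ξ))‖ ≤ (14 + |c|) * B := by
      have := intervalIntegral.norm_integral_le_of_norm_le_const (a := r) (b := r + 1)
        (C := (14 + |c|) * B) (f := fun ρ : ℝ => (((r + 1 : ℝ) : ℂ) - ρ)
        * (potential c (vertical ξ) ρ * laplace (m ρ) (vertical ξ))) fun x hx => ?_
      · simpa using this
      · have hx' := uIoc_subset_uIcc hx
        rw [norm_mul]
        have h1 : ‖((r + 1 : ℝ) : ℂ) - x‖ ≤ 1 := by
          rw [← Complex.ofReal_sub, Complex.norm_real, Real.norm_eq_abs]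
          rw [uIcc_of_le hle] at hx'
          rw [abs_le]
          constructor <;> linarith [hx'.1, hx'.2]
        calc _ ≤ 1 * ((14 + |c|) * B) := mul_le_mul h1 (hV ξ x (hmem x hx')) (norm_nonneg _)
              zero_le_one
          _ = _ := one_mul _
    have heq : laplaceDeriv m c r (vertical ξ) = laplace (m (r + 1)) (vertical ξ)
        - laplace (m r) (vertical ξ) - ∫ ρ in r..(r + 1), (((r + 1 : ℝ) : ℂ) - ρ)
        * (potential c (vertical ξ) ρ * laplace (m ρ) (vertical ξ)) := by
      rw [key]; push_cast; ring
    rw [heq]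
    refine (norm_sub_le _ _).trans ?_
    have := norm_sub_le (laplace (m (r + 1)) (vertical ξ)) (laplace (m r) (vertical ξ))
    linarith [hW ξ r hr', hW ξ (r + 1) hr1]

end Decay

section Inversion

variable {m : ℝ → ℝ → ℝ} {c : ℝ}

lemma continuous_vertical : Continuous vertical := by
  unfold vertical
  fun_prop

lemma norm_cexp_vertical_mul (ξ τ : ℝ) : ‖Complex.exp (vertical ξ * τ)‖ = rexp τ := by
  rw [Complex.norm_exp]
  simp

lemma continuous_comp_vertical {g : ℂ → ℂ} (hg : DifferentiableOn ℂ g {z | 0 < z.re}) :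
    Continuous fun ξ => g (vertical ξ) :=
  hg.continuousOn.comp_continuous continuous_vertical fun ξ => by simp

lemma integrable_of_norm_le_inv_one_add_sq {g : ℝ → ℂ} (hg : Continuous g) {C : ℝ}
    (h : ∀ ξ, ‖g ξ‖ ≤ C * (1 + ξ ^ 2)⁻¹) : Integrable g :=
  (integrable_inv_one_add_sq.const_mul C).mono' hg.aestronglyMeasurable (Eventually.of_forall h)

/-- **Laplace inversion formula** on the line `Re z = 1`. -/
lemma integral_cexp_mul_laplace {f : ℝ → ℝ}
    (hf : IntegrableOn (fun τ : ℝ => Complex.exp (-1 * τ) * (f τ : ℂ)) (Ioi 0))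
    (hL : Integrable fun ξ => laplace f (vertical ξ)) {τ : ℝ} (hτ : 0 < τ)
    (hc : ContinuousAt f τ) :
    ∫ ξ, Complex.exp (vertical ξ * τ) * laplace f (vertical ξ) = f τ := by
  set F : ℝ → ℂ := (Ioi 0).indicator fun τ : ℝ => Complex.exp (-1 * τ) * (f τ : ℂ) with hF
  have hfourier : FourierTransform.fourier F = fun ξ => laplace f (vertical ξ) := by
    ext ξ
    rw [Real.fourier_real_eq_integral_exp_smul, laplace, ← integral_indicator measurableSet_Ioi]
    congr 1
    ext t
    by_cases ht : t ∈ Ioi (0:ℝ)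
    · simp only [hF, indicator_of_mem ht, smul_eq_mul]
      rw [← mul_assoc, ← Complex.exp_add]
      congr 2
      simp only [vertical]
      push_cast
      ring
    · simp [hF, indicator_of_notMem ht]
  have hcF : ContinuousAt F τ := by
    have : ContinuousAt (fun τ : ℝ => Complex.exp (-1 * τ) * (f τ : ℂ)) τ :=
      (Continuous.continuousAt (by fun_prop)).mul (Complex.continuous_ofReal.continuousAt.comp hc)
    refine this.congr ?_
    filter_upwards [lt_mem_nhds hτ] with t ht
    simp only [hF]
    rw [indicator_of_mem (show t ∈ Ioi (0:ℝ) from ht)]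
  have key := ((integrable_indicator_iff measurableSet_Ioi).2 hf).fourierInv_fourier_eq
    (by rw [← hF, hfourier]; exact hL) hcF
  rw [← hF, hfourier, Real.fourierInv_eq'] at key
  have hFτ : F τ = Complex.exp (-1 * τ) * (f τ : ℂ) := by
    simp only [hF]
    rw [indicator_of_mem (show τ ∈ Ioi (0:ℝ) from hτ)]
  rw [hFτ] at key
  have := congrArg (fun x => Complex.exp τ * x) key
  simp only [← mul_assoc, ← Complex.exp_add] at this
  rw [← integral_const_mul] at this
  simp only [neg_mul, one_mul, add_neg_cancel, Complex.exp_zero] at this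
  rw [← this]
  congr 1
  ext ξ
  rw [smul_eq_mul, ← mul_assoc, ← Complex.exp_add]
  congr 2
  simp only [vertical, inner]
  push_cast
  simp
  ring

lemma hasDerivAt_integral_cexp_mul_left {G G' : ℝ → ℝ → ℂ} {r C₁ C₂ τ : ℝ} {s : Set ℝ}
    (hs : s ∈ nhds r) (hG : ∀ x ∈ s, Continuous (G x)) (hG' : Continuous (G' r))
    (hGb : ∀ ξ, ‖G r ξ‖ ≤ C₁ * (1 + ξ ^ 2)⁻¹)
    (hGb' : ∀ ξ, ∀ x ∈ s, ‖G' x ξ‖ ≤ C₂ * (1 + ξ ^ 2)⁻¹)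
    (hd : ∀ ξ, ∀ x ∈ s, HasDerivAt (fun x => G x ξ) (G' x ξ) x) :
    HasDerivAt (fun x => ∫ ξ, Complex.exp (vertical ξ * τ) * G x ξ)
      (∫ ξ, Complex.exp (vertical ξ * τ) * G' r ξ) r := by
  have hexp : Continuous fun ξ => Complex.exp (vertical ξ * τ) := by
    have := continuous_vertical
    fun_prop
  refine (hasDerivAt_integral_of_dominated_loc_of_deriv_le
    (F := fun x ξ => Complex.exp (vertical ξ * τ) * G x ξ)
    (F' := fun x ξ => Complex.exp (vertical ξ * τ) * G' x ξ)
    (bound := fun ξ => rexp τ * (C₂ * (1 + ξ ^ 2)⁻¹)) hs ?_ ?_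
    (hexp.mul hG').aestronglyMeasurable ?_ ?_ ?_).2
  · filter_upwards [hs] with x hx
    exact (hexp.mul (hG x hx)).aestronglyMeasurable
  · refine integrable_of_norm_le_inv_one_add_sq (C := rexp τ * C₁)
      (hexp.mul (hG r (mem_of_mem_nhds hs))) fun ξ => ?_
    rw [norm_mul, norm_cexp_vertical_mul, mul_assoc]
    exact mul_le_mul_of_nonneg_left (hGb ξ) (exp_pos _).le
  · refine Eventually.of_forall fun ξ x hx => ?_
    rw [norm_mul, norm_cexp_vertical_mul]
    exact mul_le_mul_of_nonneg_left (hGb' ξ x hx) (exp_pos _).le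
  · exact (integrable_inv_one_add_sq.const_mul _).const_mul _
  · exact Eventually.of_forall fun ξ x hx => (hd ξ x hx).const_mul _

lemma hasDerivAt_integral_cexp_mul_right {G : ℝ → ℂ} (hG : Continuous G) {C₁ C₂ τ : ℝ}
    (hGb : ∀ ξ, ‖G ξ‖ ≤ C₁ * (1 + ξ ^ 2)⁻¹)
    (hGb' : ∀ ξ, ‖vertical ξ * G ξ‖ ≤ C₂ * (1 + ξ ^ 2)⁻¹) :
    HasDerivAt (fun t : ℝ => ∫ ξ, Complex.exp (vertical ξ * t) * G ξ)
      (∫ ξ, Complex.exp (vertical ξ * τ) * (vertical ξ * G ξ)) τ := by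
  have hexp : ∀ t : ℝ, Continuous fun ξ => Complex.exp (vertical ξ * t) := by
    have := continuous_vertical
    fun_prop
  refine (hasDerivAt_integral_of_dominated_loc_of_deriv_le
    (F := fun (t : ℝ) ξ => Complex.exp (vertical ξ * t) * G ξ)
    (F' := fun (t : ℝ) ξ => Complex.exp (vertical ξ * t) * (vertical ξ * G ξ))
    (bound := fun ξ => rexp (τ + 1) * (C₂ * (1 + ξ ^ 2)⁻¹)) (Iio_mem_nhds (lt_add_one τ))
    (Eventually.of_forall fun t => ((hexp t).mul hG).aestronglyMeasurable) ?_
    ((hexp τ).mul (continuous_vertical.mul hG)).aestronglyMeasurable ?_ ?_ ?_).2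
  · refine integrable_of_norm_le_inv_one_add_sq (C := rexp τ * C₁) ((hexp τ).mul hG) fun ξ => ?_
    rw [norm_mul, norm_cexp_vertical_mul, mul_assoc]
    exact mul_le_mul_of_nonneg_left (hGb ξ) (exp_pos _).le
  · refine Eventually.of_forall fun ξ t ht => ?_
    rw [norm_mul, norm_cexp_vertical_mul]
    exact mul_le_mul (exp_le_exp.2 (le_of_lt ht)) (hGb' ξ) (norm_nonneg _) (exp_pos _).le
  · exact (integrable_inv_one_add_sq.const_mul _).const_mul _
  · refine Eventually.of_forall fun ξ t _ => ?_
    have h1 : HasDerivAt (fun t : ℝ => vertical ξ * (t:ℂ)) (vertical ξ) t := by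
      simpa using ((hasDerivAt_id t).ofReal_comp).const_mul (vertical ξ)
    exact (h1.cexp.mul_const (G ξ)).congr_deriv (by ring)

/-- If the Laplace transform of `m` solves `w'' = (2l + c/r²) w` with `c ≥ 0`, then
`m` solves `∂ᵣᵣ m = 2 ∂_τ m + (c/r²) m`. -/
theorem LaplaceSolvesODE.exists_hasDerivAt (hode : LaplaceSolvesODE m c)
    (hm : IsContinuousLocallyBounded m) (hc : 0 ≤ c) :
    ∃ mt mr : ℝ → ℝ → ℝ, ∀ r > (1:ℝ), ∀ τ > (0:ℝ),
      HasDerivAt (m r) (mt r τ) τ ∧ HasDerivAt (fun r => m r τ) (mr r τ) r ∧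
      HasDerivAt (fun r => mr r τ) (2 * mt r τ + c / r ^ 2 * m r τ) r := by
  have hre : ∀ {f : ℝ → ℂ} {f' : ℂ} {r : ℝ}, HasDerivAt f f' r →
      HasDerivAt (fun r => (f r).re) f'.re r := fun hf =>
    Complex.reCLM.hasFDerivAt.comp_hasDerivAt _ hf
  have hcL : ∀ x, 1 < x → Continuous fun ξ => laplace (m x) (vertical ξ) := fun x hx =>
    continuous_comp_vertical (differentiableOn_laplace hm hx)
  have hcD : ∀ x, 1 < x → Continuous fun ξ => laplaceDeriv m c x (vertical ξ) := fun x hx =>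
    continuous_comp_vertical (differentiableOn_laplaceDeriv hm hx)
  have hcP : ∀ x, Continuous fun ξ => potential c (vertical ξ) x := fun x => by
    have := continuous_vertical
    unfold potential
    fun_prop
  have hinv : ∀ r > (1:ℝ), ∀ τ > (0:ℝ),
      m r τ = (∫ ξ, Complex.exp (vertical ξ * τ) * laplace (m r) (vertical ξ)).re := by
    intro r hr τ hτ
    obtain ⟨C, hC⟩ := exists_norm_le_inv_one_add_sq hm hode hc r hr
    rw [integral_cexp_mul_laplace (hm.integrableOn hr (by simp))
      (integrable_of_norm_le_inv_one_add_sq (hcL r hr) fun ξ => (hC ξ r ⟨le_rfl, le_rfl⟩).1) hτ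
      ((hm.continuousOn_right hr).continuousAt (Ici_mem_nhds hτ)), Complex.ofReal_re]
  refine ⟨fun r τ => (∫ ξ, Complex.exp (vertical ξ * τ)
      * (vertical ξ * laplace (m r) (vertical ξ))).re,
    fun r τ => (∫ ξ, Complex.exp (vertical ξ * τ) * laplaceDeriv m c r (vertical ξ)).re,
    fun r hr τ hτ => ?_⟩
  obtain ⟨C, hC⟩ := exists_norm_le_inv_one_add_sq hm hode hc (r + 1)
    (show 1 < (1 + r) / 2 by linarith)
  have hrs : Icc ((1 + r) / 2) (r + 1) ∈ nhds r := Icc_mem_nhds (by linarith) (by linarith)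
  have hr' := mem_of_mem_nhds hrs
  have hgt : ∀ x ∈ Icc ((1 + r) / 2) (r + 1), 1 < x := fun x hx => by linarith [hx.1]
  have hexp : Continuous fun ξ => Complex.exp (vertical ξ * τ) := by
    have := continuous_vertical
    fun_prop
  refine ⟨?_, ?_, ?_⟩
  · refine (hre (hasDerivAt_integral_cexp_mul_right (hcL r hr) (fun ξ => (hC ξ r hr').1)
      fun ξ => (hC ξ r hr').2.1)).congr_of_eventuallyEq ?_
    filter_upwards [lt_mem_nhds hτ] with t ht
    exact hinv r hr t ht
  · refine (hre (hasDerivAt_integral_cexp_mul_left (G := fun x ξ => laplace (m x) (vertical ξ))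
      (G' := fun x ξ => laplaceDeriv m c x (vertical ξ)) hrs
      (fun x hx => hcL x (hgt x hx)) (hcD r hr) (fun ξ => (hC ξ r hr').1)
      (fun ξ x hx => (hC ξ x hx).2.2.2)
      fun ξ x hx => hasDerivAt_laplace_left hm hode (hgt x hx) (by simp))).congr_of_eventuallyEq ?_
    filter_upwards [lt_mem_nhds hr] with x hx
    exact hinv x hx τ hτ
  · refine (hre (hasDerivAt_integral_cexp_mul_left
      (G := fun x ξ => laplaceDeriv m c x (vertical ξ))
      (G' := fun x ξ => potential c (vertical ξ) x * laplace (m x) (vertical ξ)) hrs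
      (fun x hx => hcD x (hgt x hx)) ((hcP r).mul (hcL r hr)) (fun ξ => (hC ξ r hr').2.2.2)
      (fun ξ x hx => (hC ξ x hx).2.2.1)
      fun ξ x hx => hasDerivAt_laplaceDeriv hm (hgt x hx) (by simp))).congr_deriv ?_
    have hbd : ∀ {G : ℝ → ℂ}, Continuous G → (∀ ξ, ‖G ξ‖ ≤ C * (1 + ξ ^ 2)⁻¹) →
        Integrable fun ξ => Complex.exp (vertical ξ * τ) * G ξ := fun hG h =>
      integrable_of_norm_le_inv_one_add_sq (C := rexp τ * C) (hexp.mul hG) fun ξ => by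
        rw [norm_mul, norm_cexp_vertical_mul, mul_assoc]
        exact mul_le_mul_of_nonneg_left (h ξ) (exp_pos _).le
    have i1 := hbd (hcL r hr) fun ξ => (hC ξ r hr').1
    have i2 := hbd (G := fun ξ => vertical ξ * laplace (m r) (vertical ξ))
      (continuous_vertical.mul (hcL r hr)) fun ξ => (hC ξ r hr').2.1
    have hsplit : ∫ ξ, Complex.exp (vertical ξ * τ)
          * (potential c (vertical ξ) r * laplace (m r) (vertical ξ))
        = ((2 : ℝ) : ℂ) * (∫ ξ, Complex.exp (vertical ξ * τ)
            * (vertical ξ * laplace (m r) (vertical ξ)))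
          + ((c / r ^ 2 : ℝ) : ℂ)
            * ∫ ξ, Complex.exp (vertical ξ * τ) * laplace (m r) (vertical ξ) := by
      rw [← integral_const_mul, ← integral_const_mul,
        ← integral_add (i2.const_mul _) (i1.const_mul _)]
      congr 1
      ext ξ
      simp only [potential]
      push_cast
      ring
    rw [hsplit, Complex.add_re, Complex.re_ofReal_mul, Complex.re_ofReal_mul, ← hinv r hr τ hτ]

end Inversion

section Radial

variable {φ : ℝ → ℝ → ℝ} {s : ℝ}

lemma isContinuousLocallyBounded_rpow_mul (hs : 0 ≤ s)
    (hbdd : ∃ C : ℝ, ∀ r > (1:ℝ), ∀ τ ≥ (0:ℝ), |φ r τ| ≤ C)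
    (hcont : ContinuousOn (fun p : ℝ × ℝ => φ p.1 p.2) (Ioi 1 ×ˢ Ici 0)) :
    IsContinuousLocallyBounded fun r τ => r ^ s * φ r τ where
  continuousOn := by
    refine ContinuousOn.mul (fun p hp => ?_) hcont
    have hp1 : (1:ℝ) < p.1 := hp.1
    exact (continuousAt_fst.rpow_const (Or.inl (by positivity))).continuousWithinAt
  bounded b := by
    obtain ⟨C, hC⟩ := hbdd
    refine ⟨b ^ s * C, fun r hr hrb τ hτ => ?_⟩
    have hr0 : 0 < r := by linarith
    rw [abs_mul, abs_of_pos (rpow_pos_of_pos hr0 s)]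
    exact mul_le_mul (rpow_le_rpow hr0.le hrb hs) (hC r hr τ hτ) (abs_nonneg _)
      (rpow_nonneg (hr0.le.trans hrb) _)

lemma laplaceSolvesODE_rpow_mul {v α : ℝ} (hs : 1 ≤ s) (hv : v + 1/2 = s)
    (hK : ∀ r > (1:ℝ), ∀ l > (0:ℝ), (∫ τ in Ioi (0:ℝ), rexp (-l*τ) * φ r τ) =
      α * r ^ (-v) * besselK v (r * √(2*l)) / (l * besselK v √(2*l))) :
    LaplaceSolvesODE (fun r τ => r ^ s * φ r τ) (s * (s - 1)) := by
  intro l hl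
  set a := √(2*l) with ha
  have ha0 : 0 < a := sqrt_pos.2 (by linarith)
  have ha2 : a ^ 2 = 2 * l := sq_sqrt (by linarith)
  obtain ⟨w₁, hw⟩ := exists_hasDerivAt_rpow_mul_cosKernelIntegral hs ha0
    (α * (π ^ (-(1:ℝ)/2) * Gamma s * (2 * a) ^ v) / (l * besselK v a))
  have heq : ∀ r > (1:ℝ), (∫ τ in Ioi (0:ℝ), rexp (-l*τ) * (r ^ s * φ r τ)) =
      α * (π ^ (-(1:ℝ)/2) * Gamma s * (2 * a) ^ v) / (l * besselK v a)
        * (r ^ s * cosKernelIntegral s (r * a)) := by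
    intro r hr
    have hr0 : 0 < r := by linarith
    have h1 : (∫ τ in Ioi (0:ℝ), rexp (-l*τ) * (r ^ s * φ r τ))
        = r ^ s * ∫ τ in Ioi (0:ℝ), rexp (-l*τ) * φ r τ := by
      rw [← integral_const_mul]
      congr 1
      ext τ
      ring
    have h2 : (2 * (r * a)) ^ v = r ^ v * (2 * a) ^ v := by
      rw [← mul_rpow hr0.le (by positivity)]
      congr 1
      ring
    have h3 : r ^ (-v) * r ^ v = 1 := by
      rw [← rpow_add hr0, neg_add_cancel, rpow_zero]
    rw [h1, hK r hr l hl, besselK_eq v (r * a), hv, h2]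
    linear_combination (r ^ s * α * (π ^ (-(1:ℝ)/2) * Gamma s * (2 * a) ^ v)
      * cosKernelIntegral s (r * a) / (l * besselK v a)) * h3
  refine ⟨w₁, fun r hr => ⟨(hw r (by linarith)).1.congr_of_eventuallyEq ?_, ?_⟩⟩
  · filter_upwards [lt_mem_nhds hr] with x hx
    exact heq x hx
  · rw [heq r hr, ← ha2]
    exact (hw r (by linarith)).2

/-- If `r ^ s φ` solves `∂ᵣᵣ m = 2 ∂_τ m + (s(s-1)/r²) m`, then `φ` solves the radial heat
equation in dimension `2s + 1`. -/
lemma deriv_eq_of_rpow_mul {mt mr : ℝ → ℝ → ℝ}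
    (h : ∀ r > (1:ℝ), ∀ τ > (0:ℝ),
      HasDerivAt (fun τ => r ^ s * φ r τ) (mt r τ) τ ∧
      HasDerivAt (fun r => r ^ s * φ r τ) (mr r τ) r ∧
      HasDerivAt (fun r => mr r τ) (2 * mt r τ + s * (s - 1) / r ^ 2 * (r ^ s * φ r τ)) r)
    {r τ : ℝ} (hr : 1 < r) (hτ : 0 < τ) :
    deriv (fun τ' => φ r τ') τ =
      (1/2) * deriv (deriv (fun r' => φ r' τ)) r + (s / r) * deriv (fun r' => φ r' τ) r := by
  have hcancel : ∀ x > (1:ℝ), ∀ t, φ x t = x ^ (-s) * (x ^ s * φ x t) := by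
    intro x hx t
    have hx0 : 0 < x := by linarith
    rw [← mul_assoc, ← rpow_add hx0, neg_add_cancel, rpow_zero, one_mul]
  have ht : deriv (fun τ' => φ r τ') τ = r ^ (-s) * mt r τ := by
    refine HasDerivAt.deriv ?_
    refine ((h r hr τ hτ).1.const_mul (r ^ (-s))).congr_of_eventuallyEq ?_
    exact Eventually.of_forall fun t => hcancel r hr t
  have h1 : ∀ x > (1:ℝ), deriv (fun r' => φ r' τ) x
      = x ^ (-s) * (-s / x * (x ^ s * φ x τ) + mr x τ) := by
    intro x hx
    refine HasDerivAt.deriv ?_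
    refine (hasDerivAt_rpow_mul_twice (p := -s) (f₁ := fun r => mr r τ) (by linarith)
      (h x hx τ hτ).2.1 (h x hx τ hτ).2.2).1.congr_of_eventuallyEq ?_
    filter_upwards [lt_mem_nhds hx] with y hy
    exact hcancel y hy τ
  have h2 := ((hasDerivAt_rpow_mul_twice (p := -s) (f₁ := fun r => mr r τ) (by linarith)
      (h r hr τ hτ).2.1 (h r hr τ hτ).2.2).2.congr_of_eventuallyEq (by
    filter_upwards [lt_mem_nhds hr] with y hy
    exact h1 y hy)).deriv
  have hr0 : r ≠ 0 := by linarith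
  rw [ht, h2, h1 r hr]
  field_simp
  ring

end Radial

theorem stmt_0 (d : ℕ) (hd : 1 ≤ d) (v : ℝ) (hv : v = ((d : ℝ) - 2)/2)
    (α : ℝ) (hα : α ∈ Set.Ioc (0:ℝ) 1)
    (φ : ℝ → ℝ → ℝ)
    (hbdd : ∃ C : ℝ, ∀ r > (1:ℝ), ∀ τ ≥ (0:ℝ), |φ r τ| ≤ C)
    (hcont : ContinuousOn (fun p : ℝ × ℝ => φ p.1 p.2) (Set.Ioi 1 ×ˢ Set.Ici 0))
    (hC2r : ∀ τ > (0:ℝ), ContDiffOn ℝ 2 (fun r => φ r τ) (Set.Ioi 1))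
    (hC1τ : ∀ r > (1:ℝ), ContDiffOn ℝ 1 (fun τ => φ r τ) (Set.Ioi 0))
    (hinit : ∀ r > (1:ℝ), φ r 0 = 0)
    (hK : ∀ r > (1:ℝ), ∀ l > (0:ℝ),
      besselK v (Real.sqrt (2*l)) ≠ 0 ∧
      (∫ τ in Set.Ioi (0:ℝ), Real.exp (-l*τ) * φ r τ) =
        α * r ^ (-v) * besselK v (r * Real.sqrt (2*l)) /
          (l * besselK v (Real.sqrt (2*l))))
    (hLexist : ∀ r > (1:ℝ), ∀ l > (0:ℝ),
      IntegrableOn (fun τ => Real.exp (-l*τ) * deriv (fun r' => φ r' τ) r) (Set.Ioi 0) ∧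
      IntegrableOn (fun τ => Real.exp (-l*τ) * deriv (deriv (fun r' => φ r' τ)) r) (Set.Ioi 0) ∧
      IntegrableOn (fun τ => Real.exp (-l*τ) * deriv (fun τ' => φ r τ') τ) (Set.Ioi 0))
    (hLr : ∀ r > (1:ℝ), ∀ l > (0:ℝ),
      (∫ τ in Set.Ioi (0:ℝ), Real.exp (-l*τ) * deriv (fun r' => φ r' τ) r) =
        deriv (fun r' => ∫ τ in Set.Ioi (0:ℝ), Real.exp (-l*τ) * φ r' τ) r)
    (hLrr : ∀ r > (1:ℝ), ∀ l > (0:ℝ),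
      (∫ τ in Set.Ioi (0:ℝ), Real.exp (-l*τ) * deriv (deriv (fun r' => φ r' τ)) r) =
        deriv (deriv (fun r' => ∫ τ in Set.Ioi (0:ℝ), Real.exp (-l*τ) * φ r' τ)) r)
    (hLτ : ∀ r > (1:ℝ), ∀ l > (0:ℝ),
      (∫ τ in Set.Ioi (0:ℝ), Real.exp (-l*τ) * deriv (fun τ' => φ r τ') τ) =
        l * ∫ τ in Set.Ioi (0:ℝ), Real.exp (-l*τ) * φ r τ) :
    ∀ r > (1:ℝ), ∀ τ > (0:ℝ),
      deriv (fun τ' => φ r τ') τ =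
        (1/2) * deriv (deriv (fun r' => φ r' τ)) r +
          (((d : ℝ) - 1)/(2*r)) * deriv (fun r' => φ r' τ) r := by
  have hv_neg : v ≠ -(1/2) := by
    rintro rfl
    exact (hK 2 one_lt_two 1 one_pos).1 (besselK_neg_half _)
  have hv_zero : v ≠ 0 := by
    rintro rfl
    exact (hK 2 one_lt_two 1 one_pos).1 (besselK_zero (by positivity))
  have hd3 : (3:ℝ) ≤ d := by
    have : d ≠ 1 := by
      rintro rfl
      exact hv_neg (by rw [hv]; norm_num)
    have : d ≠ 2 := by
      rintro rfl
      exact hv_zero (by rw [hv]; norm_num)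
    exact_mod_cast (by omega : 3 ≤ d)
  set s : ℝ := ((d:ℝ) - 1) / 2 with hs
  have hs1 : 1 ≤ s := by rw [hs]; linarith
  have hode := laplaceSolvesODE_rpow_mul (s := s) hs1 (by rw [hv, hs]; ring)
    fun r hr l hl => (hK r hr l hl).2
  obtain ⟨mt, mr, h⟩ := hode.exists_hasDerivAt
    (isContinuousLocallyBounded_rpow_mul (by linarith) hbdd hcont)
    (mul_nonneg (by linarith) (by linarith))
  intro r hr τ hτ
  rw [deriv_eq_of_rpow_mul h hr hτ, hs, div_div]
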